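/- arXiv:2511.14975 — 2 statements merged into one kernel-verified Lean document; each statement's English description precedes it below -/
import Mathlib

section
/- For every nonempty set S of crossing types, a graph is S-restricted if and only if all of its 2-connected components (blocks) are S-restricted. -/
open scoped unitInterval

namespace OnePlanarity

/-- The six crossing types of a crossing in a 1-planar drawing. -/
inductive CrossingType : Type
  | full | almostFull | bowtie | arrow | chair | timesCross
  deriving DecidableEq

/-- The three crossing types in which the four endpoints of the crossing edges
lie on a common 4-cycle using the two crossing edges. -/
def goodTypes : Set CrossingType :=
  {CrossingType.full, CrossingType.almostFull, CrossingType.bowtie}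

/-- The three "bad" crossing types. -/
def badTypes : Set CrossingType :=
  {CrossingType.arrow, CrossingType.chair, CrossingType.timesCross}

variable {V : Type*} {W : Type*}

/-- `HasCrossingType G a b c d t` says that, assuming the edges `ab` and `cd` of `G`
cross, the subgraph of `G` induced by `{a,b,c,d}` witnesses the crossing type `t`. -/
def HasCrossingType (G : SimpleGraph V) (a b c d : V) : CrossingType → Prop
  | .full => G.Adj a c ∧ G.Adj a d ∧ G.Adj b c ∧ G.Adj b d
  | .almostFull =>
      (¬G.Adj a c ∧ G.Adj a d ∧ G.Adj b c ∧ G.Adj b d) ∨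
      (G.Adj a c ∧ ¬G.Adj a d ∧ G.Adj b c ∧ G.Adj b d) ∨
      (G.Adj a c ∧ G.Adj a d ∧ ¬G.Adj b c ∧ G.Adj b d) ∨
      (G.Adj a c ∧ G.Adj a d ∧ G.Adj b c ∧ ¬G.Adj b d)
  | .bowtie =>
      (G.Adj a c ∧ G.Adj b d ∧ ¬G.Adj a d ∧ ¬G.Adj b c) ∨
      (G.Adj a d ∧ G.Adj b c ∧ ¬G.Adj a c ∧ ¬G.Adj b d)
  | .arrow =>
      (G.Adj a c ∧ G.Adj a d ∧ ¬G.Adj b c ∧ ¬G.Adj b d) ∨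
      (G.Adj b c ∧ G.Adj b d ∧ ¬G.Adj a c ∧ ¬G.Adj a d) ∨
      (G.Adj a c ∧ G.Adj b c ∧ ¬G.Adj a d ∧ ¬G.Adj b d) ∨
      (G.Adj a d ∧ G.Adj b d ∧ ¬G.Adj a c ∧ ¬G.Adj b c)
  | .chair =>
      (G.Adj a c ∧ ¬G.Adj a d ∧ ¬G.Adj b c ∧ ¬G.Adj b d) ∨
      (¬G.Adj a c ∧ G.Adj a d ∧ ¬G.Adj b c ∧ ¬G.Adj b d) ∨
      (¬G.Adj a c ∧ ¬G.Adj a d ∧ G.Adj b c ∧ ¬G.Adj b d) ∨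
      (¬G.Adj a c ∧ ¬G.Adj a d ∧ ¬G.Adj b c ∧ G.Adj b d)
  | .timesCross => ¬G.Adj a c ∧ ¬G.Adj a d ∧ ¬G.Adj b c ∧ ¬G.Adj b d

/-- `IsArc A x y` says that `A` is the image of a simple curve from `x` to `y`. -/
def IsArc (A : Set (ℝ × ℝ)) (x y : ℝ × ℝ) : Prop :=
  ∃ f : I → ℝ × ℝ, Continuous f ∧ Function.Injective f ∧
    f 0 = x ∧ f 1 = y ∧ Set.range f = A

/-- A drawing of a graph `G` in the plane: vertices are mapped to distinct points,
every edge is mapped to a simple curve between the images of its endpoints avoiding the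
images of all other vertices, and two edges intersect in finitely many points. -/
structure Drawing (G : SimpleGraph V) where
  pos : V → ℝ × ℝ
  pos_inj : Function.Injective pos
  arc : Sym2 V → Set (ℝ × ℝ)
  arc_curve : ∀ e ∈ G.edgeSet, ∀ u v : V, e = s(u, v) → IsArc (arc e) (pos u) (pos v)
  arc_avoid : ∀ e ∈ G.edgeSet, ∀ w : V, pos w ∈ arc e → w ∈ e
  arc_finite_inter : ∀ e ∈ G.edgeSet, ∀ e' ∈ G.edgeSet, e ≠ e' →
    (arc e ∩ arc e').Finite

variable {G : SimpleGraph V}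

/-- `D.Crosses e e' p` : the distinct edges `e` and `e'` of `G` cross at the point `p`
(an intersection point of their curves which is not the image of a vertex). -/
def Drawing.Crosses (D : Drawing G) (e e' : Sym2 V) (p : ℝ × ℝ) : Prop :=
  e ∈ G.edgeSet ∧ e' ∈ G.edgeSet ∧ e ≠ e' ∧
    p ∈ D.arc e ∧ p ∈ D.arc e' ∧ p ∉ Set.range D.pos

/-- A drawing is 1-planar if every edge is involved in at most one crossing and
adjacent edges do not cross. -/
def Drawing.IsOnePlanar (D : Drawing G) : Prop :=
  (∀ e e₁ e₂ p q, D.Crosses e e₁ p → D.Crosses e e₂ q → e₁ = e₂ ∧ p = q) ∧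
  (∀ e e' p, D.Crosses e e' p → ∀ v : V, v ∈ e → v ∉ e')

/-- A drawing is `S`-restricted if it is 1-planar and every crossing has a type in `S`. -/
def Drawing.IsSRestricted (D : Drawing G) (S : Set CrossingType) : Prop :=
  D.IsOnePlanar ∧
  ∀ a b c d : V, ∀ p : ℝ × ℝ, D.Crosses s(a, b) s(c, d) p →
    ∃ t ∈ S, HasCrossingType G a b c d t

/-- A graph is 1-planar if it admits a 1-planar drawing. -/
def IsOnePlanarGraph (G : SimpleGraph V) : Prop :=
  ∃ D : Drawing G, D.IsOnePlanar

/-- A graph is `S`-restricted if it admits an `S`-restricted drawing. -/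
def SRestricted (G : SimpleGraph V) (S : Set CrossingType) : Prop :=
  ∃ D : Drawing G, D.IsSRestricted S

/-- A planar graph: one admitting a crossing-free drawing. -/
def IsPlanarGraph (G : SimpleGraph V) : Prop :=
  ∃ D : Drawing G, ∀ e e' p, ¬ D.Crosses e e' p

/-- A drawing is geometric if every edge is drawn as a straight-line segment. -/
def Drawing.IsGeometric (D : Drawing G) : Prop :=
  ∀ u v : V, G.Adj u v → D.arc s(u, v) = segment ℝ (D.pos u) (D.pos v)

/-- The point set of a drawing. -/
def Drawing.image (D : Drawing G) : Set (ℝ × ℝ) :=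
  Set.range D.pos ∪ ⋃ e ∈ G.edgeSet, D.arc e

/-- The set of points of the outer (unbounded) face of a point set `A`. -/
def outerRegion (A : Set (ℝ × ℝ)) : Set (ℝ × ℝ) :=
  {x | x ∉ A ∧ ¬ Bornology.IsBounded (connectedComponentIn Aᶜ x)}

/-- `Inside γ x` : the point `x` is separated from the outer face by the closed curve `γ`. -/
def Inside (γ : Set (ℝ × ℝ)) (x : ℝ × ℝ) : Prop :=
  x ∉ γ ∧ Bornology.IsBounded (connectedComponentIn γᶜ x)

/-- A vertex lies on (the boundary of) the outer face of a drawing. -/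
def Drawing.OnOuterFace (D : Drawing G) (v : V) : Prop :=
  D.pos v ∈ closure (outerRegion D.image)

/-- Two vertices are cofacial: they lie on the boundary of a common face. -/
def Drawing.Cofacial (D : Drawing G) (u v : V) : Prop :=
  ∃ p : ℝ × ℝ, p ∉ D.image ∧
    D.pos u ∈ closure (connectedComponentIn D.imageᶜ p) ∧
    D.pos v ∈ closure (connectedComponentIn D.imageᶜ p)

/-- A graph admits a geometric `S`-restricted drawing. -/
def GeoSRestricted (G : SimpleGraph V) (S : Set CrossingType) : Prop :=
  ∃ D : Drawing G, D.IsGeometric ∧ D.IsSRestricted S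

/-- `OGeoSRestricted G S O` : the graph `G` admits a geometric `S`-restricted drawing
in which the vertex of `O` (if any) lies on the outer face. -/
def OGeoSRestricted (G : SimpleGraph V) (S : Set CrossingType) (O : Set V) : Prop :=
  ∃ D : Drawing G, D.IsGeometric ∧ D.IsSRestricted S ∧ ∀ v ∈ O, D.OnOuterFace v

/-- `k`-connectivity. -/
def KConnected (k : ℕ) (G : SimpleGraph V) : Prop :=
  k < Nat.card V ∧ ∀ T : Set V, T.ncard < k → (G.induce Tᶜ).Connected

/-- A vertex has degree exactly two. -/
def DegTwo (G : SimpleGraph V) (w : V) : Prop :=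
  ∃ a b : V, a ≠ b ∧ G.neighborSet w = {a, b}

/-- The simple graph obtained from `G` by suppressing the degree-2 vertices in `W`. -/
def suppress (G : SimpleGraph V) (Ws : Set V) : SimpleGraph {v : V // v ∉ Ws} :=
  SimpleGraph.fromRel (fun a b =>
    G.Adj a.1 b.1 ∨ ∃ w ∈ Ws, G.Adj w a.1 ∧ G.Adj w b.1)

/-- A graph is internally 3-connected if it is obtained from a 3-connected (multi)graph by
subdividing a subset of its edges once each. -/
def InternallyThreeConnected (G : SimpleGraph V) : Prop :=
  ∃ Ws : Set V, (∀ w ∈ Ws, DegTwo G w) ∧ (∀ w ∈ Ws, ∀ u ∈ Ws, ¬ G.Adj w u) ∧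
    KConnected 3 (suppress G Ws)

/-- `IsSeparation G T X₁ X₂` : `(X₁, X₂)` is a separation of `G` induced by the separator `T`. -/
def IsSeparation (G : SimpleGraph V) (T X₁ X₂ : Set V) : Prop :=
  X₁ ∪ X₂ = Set.univ ∧ X₁ ∩ X₂ = T ∧ (X₁ \ T).Nonempty ∧ (X₂ \ T).Nonempty ∧
  ∀ u ∈ X₁ \ T, ∀ v ∈ X₂ \ T, ∀ p : G.Walk u v, ∃ w ∈ T, w ∈ p.support

end OnePlanarity
namespace OnePlanarity

variable {V : Type*}

/-- A block (2-connected component) of `G`: a maximal vertex set inducing a connected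
subgraph without a cutvertex. -/
def IsBlock (G : SimpleGraph V) (B : Set V) : Prop :=
  B.Nonempty ∧ (G.induce B).Preconnected ∧
    (∀ v : V, (G.induce (B \ {v})).Preconnected) ∧
    ∀ B' : Set V, B ⊆ B' → B'.Nonempty → (G.induce B').Preconnected →
      (∀ v : V, (G.induce (B' \ {v})).Preconnected) → B = B'

/-- The graph `G[X] + {s t, t s'}` obtained from the induced subgraph `G[X]` by adding a
new vertex `t` (the `Sum.inr` vertex) adjacent exactly to `s` and `s'`. -/
def augment (G : SimpleGraph V) (X : Set V) (s s' : V) : SimpleGraph (↥X ⊕ Unit) :=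
  SimpleGraph.fromRel (fun a b =>
    (∃ u v : X, a = Sum.inl u ∧ b = Sum.inl v ∧ G.Adj u.1 v.1) ∨
    (∃ u : X, a = Sum.inl u ∧ ((u : V) = s ∨ (u : V) = s') ∧ b = Sum.inr ()))

/-- The copy of a set `O ⊆ V` inside the vertex set of `augment G X s s'`. -/
def liftO (X O : Set V) : Set (↥X ⊕ Unit) :=
  {x | ∃ u : X, x = Sum.inl u ∧ (u : V) ∈ O}

end OnePlanarity
namespace OnePlanarity

section Arcs

variable {P Q : Type*} [TopologicalSpace P] [TopologicalSpace Q]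

/-- `IsArc` for an arbitrary topological space in place of the plane. -/
def IsArcIn (A : Set P) (x y : P) : Prop :=
  ∃ f : I → P, Continuous f ∧ Function.Injective f ∧ f 0 = x ∧ f 1 = y ∧ Set.range f = A

theorem IsArcIn.symm {A : Set P} {x y : P} (h : IsArcIn A x y) : IsArcIn A y x := by
  obtain ⟨f, hc, hi, h0, h1, hA⟩ := h
  refine ⟨f ∘ unitInterval.symm, hc.comp unitInterval.continuous_symm,
    hi.comp unitInterval.symm_bijective.injective, by simp [h1], by simp [h0], ?_⟩
  rw [Set.range_comp, unitInterval.symm_bijective.surjective.range_eq, Set.image_univ, hA]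

theorem IsArcIn.isCompact {A : Set P} {x y : P} (h : IsArcIn A x y) : IsCompact A := by
  obtain ⟨f, hc, -, -, -, rfl⟩ := h
  exact isCompact_range hc

theorem IsArcIn.image {A : Set P} {x y : P} (h : IsArcIn A x y) {φ : P → Q}
    (hφ : ContinuousOn φ A) (hi : Set.InjOn φ A) : IsArcIn (φ '' A) (φ x) (φ y) := by
  obtain ⟨f, hc, hf, rfl, rfl, rfl⟩ := h
  refine ⟨φ ∘ f, hφ.comp_continuous hc fun t => Set.mem_range_self t, fun s t hst => ?_,
    rfl, rfl, Set.range_comp φ f⟩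
  exact hf (hi (Set.mem_range_self s) (Set.mem_range_self t) hst)

/-- An arc leaving a closed disc around its first endpoint can be rerouted so that it runs
along a radius of the disc and then stays outside of the disc. -/
theorem IsArcIn.exists_radial {A : Set ℂ} {c y : ℂ} (h : IsArcIn A c y) {r : ℝ} (hr : 0 < r)
    (hy : r < dist y c) :
    ∃ (A' : Set ℂ) (q : ℂ), IsArcIn A' c y ∧ dist q c = r ∧ q ∈ A ∧
      A' ⊆ segment ℝ c q ∪ {p ∈ A | r < dist p c} := by
  obtain ⟨f, hc, hf, h0, rfl, rfl⟩ := h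
  have hd : Continuous fun s => dist (f s) c := hc.dist continuous_const
  obtain ⟨t, ht, hmax⟩ := (isClosed_le hd continuous_const : IsClosed {s | dist (f s) c ≤ r})
    |>.isCompact.exists_isMaxOn ⟨0, by simp [h0, hr.le]⟩ continuousOn_id
  have hlast : ∀ s, t < s → r < dist (f s) c := fun s hs => by
    by_contra! hle
    exact absurd (hmax hle) (not_le.2 hs)
  have hdist : dist (f t) c = r := by
    obtain ⟨s, hs, hsr⟩ := intermediate_value_Icc (f := fun s : I => dist (f s) c)
      (show t ≤ 1 from t.2.2) hd.continuousOn ⟨ht, hy.le⟩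
    have : s ≤ t := hmax (show dist (f s) c ≤ r from hsr.le)
    rwa [le_antisymm this hs.1] at hsr
  have hne : f t ≠ c := by
    rintro h
    rw [h, dist_self] at hdist
    exact hr.ne hdist
  have ht0 : 0 < (t : ℝ) := by
    refine lt_of_le_of_ne t.2.1 fun h => hne ?_
    rw [← h0]
    exact congrArg f (Subtype.ext h.symm)
  have ht1 : t ≠ 1 := by
    rintro rfl
    exact hy.ne' hdist
  have hsub : f t - c ≠ 0 := sub_ne_zero.2 hne
  have hseg : ∀ s : I, s ≤ t → c + ((s / t : ℝ) : ℂ) * (f t - c) ∈ segment ℝ c (f t) := by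
    intro s hs
    rw [segment_eq_image']
    refine ⟨(s / t : ℝ), ⟨div_nonneg s.2.1 ht0.le, (div_le_one ht0).2 hs⟩, ?_⟩
    simp
  have hball : ∀ p ∈ segment ℝ c (f t), dist p c ≤ r := fun p hp =>
    (convex_closedBall c r).segment_subset (Metric.mem_closedBall_self hr.le)
      (Metric.mem_closedBall.2 hdist.le) hp
  set g : I → ℂ := fun s => if s ≤ t then c + ((s / t : ℝ) : ℂ) * (f t - c) else f s with hg
  have hg1 : ∀ s, s ≤ t → g s = c + ((s / t : ℝ) : ℂ) * (f t - c) := fun s hs => if_pos hs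
  have hg2 : ∀ s, t < s → g s = f s := fun s hs => if_neg (not_le.2 hs)
  refine ⟨Set.range g, f t, ⟨g, ?_, ?_, ?_, ?_, rfl⟩, hdist, Set.mem_range_self t, ?_⟩
  · refine Continuous.if_le ?_ hc continuous_id continuous_const ?_
    · fun_prop
    · rintro s rfl
      simp [ht0.ne']
  · have key : ∀ s s', s ≤ t → t < s' → g s ≠ g s' := fun s s' hs hs' heq => by
      have h1 := hball _ (hseg s hs)
      rw [← hg1 s hs, heq, hg2 s' hs'] at h1
      exact absurd (hlast s' hs') (not_lt.2 h1)
    intro s s' heq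
    rcases le_or_gt s t with hs | hs <;> rcases le_or_gt s' t with hs' | hs'
    · rw [hg1 s hs, hg1 s' hs'] at heq
      have := mul_right_cancel₀ hsub (add_left_cancel heq)
      have := Complex.ofReal_injective this
      rw [div_left_inj' ht0.ne'] at this
      exact Subtype.ext this
    · exact absurd heq (key _ _ hs hs')
    · exact absurd heq.symm (key _ _ hs' hs)
    · rw [hg2 s hs, hg2 s' hs'] at heq
      exact hf heq
  · rw [hg1 0 t.2.1]
    simp
  · exact hg2 1 (lt_of_le_of_ne t.2.2 ht1)
  · rintro _ ⟨s, rfl⟩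
    rcases le_or_gt s t with hs | hs
    · left
      rw [hg1 s hs]
      exact hseg s hs
    · right
      rw [hg2 s hs]
      exact ⟨Set.mem_range_self s, hlast s hs⟩

/-- The plane slit along a half-open segment from `c` to `q` embeds into the right half plane
together with the origin, with `c` going to the origin. -/
theorem exists_map_slit_halfPlane {c q : ℂ} (hq : q ≠ c) :
    ∃ φ : ℂ → ℂ, ContinuousOn φ {z | z ∈ segment ℝ c q → z = c} ∧
      Set.InjOn φ {z | z ∈ segment ℝ c q → z = c} ∧ φ c = 0 ∧
      ∀ z, (z ∈ segment ℝ c q → z = c) → z ≠ c → 0 < (φ z).re := by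
  have hqc : q - c ≠ 0 := sub_ne_zero.2 hq
  set m : ℂ → ℂ := fun z => (z - c) / (z - q) with hm
  have hzq : ∀ z, (z ∈ segment ℝ c q → z = c) → z - q ≠ 0 := by
    intro z hz h
    rw [sub_eq_zero] at h
    subst h
    exact hq (hz (right_mem_segment ℝ c z))
  have hslit : ∀ z, (z ∈ segment ℝ c q → z = c) → z ≠ c → m z ∈ Complex.slitPlane := by
    intro z hz hzc
    rw [Complex.mem_slitPlane_iff_not_le_zero]
    intro hle
    obtain ⟨hre, him⟩ := Complex.le_def.1 hle
    obtain ⟨x, hx⟩ : ∃ x : ℝ, m z = x := ⟨(m z).re, Complex.ext rfl him⟩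
    have hx0 : x ≤ 0 := by simpa [hx] using hre
    apply hzc
    apply hz
    rw [segment_eq_image']
    have h1 : (1 - x : ℝ) ≠ 0 := by linarith
    have h1' : (1 - x : ℂ) ≠ 0 := by exact_mod_cast h1
    refine ⟨-x / (1 - x), ⟨div_nonneg (by linarith) (by linarith),
      (div_le_one (by linarith)).2 (by linarith)⟩, ?_⟩
    have h2 : z - c = x * (z - q) := by
      rw [← hx, hm]
      field_simp [hzq z hz]
    simp only [Complex.real_smul]
    push_cast
    field_simp
    linear_combination -h2
  refine ⟨fun z => m z ^ ((2 : ℕ)⁻¹ : ℂ), ?_, ?_, ?_, ?_⟩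
  · intro z hz
    have hmc : ContinuousAt m z := by
      refine ContinuousAt.div (by fun_prop) (by fun_prop) (hzq z hz)
    refine ContinuousAt.continuousWithinAt (ContinuousAt.comp
      (g := fun w : ℂ => w ^ ((2 : ℕ)⁻¹ : ℂ))
      (Complex.continuousAt_cpow_const_of_re_pos ?_ (by norm_num)) hmc)
    by_cases hzc : z = c
    · simp [hm, hzc]
    · exact (hslit z hz hzc).imp le_of_lt id
  · intro z hz w hw h
    have h' := congrArg (· ^ 2) h
    simp only [Complex.cpow_nat_inv_pow _ (two_ne_zero)] at h'
    rw [hm] at h'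
    simp only at h'
    rw [div_eq_div_iff (hzq z hz) (hzq w hw)] at h'
    have : (q - c) * (z - w) = 0 := by linear_combination -h'
    exact sub_eq_zero.1 ((mul_eq_zero.1 this).resolve_left hqc)
  · simp [hm]
  · intro z hz hzc
    have hs := hslit z hz hzc
    have hne := Complex.slitPlane_ne_zero hs
    have harg := Complex.mem_slitPlane_iff_arg.1 hs
    have h1 := Complex.neg_pi_lt_arg (m z)
    have h2 := lt_of_le_of_ne (Complex.arg_le_pi (m z)) harg.1
    simp only [Complex.cpow_def_of_ne_zero hne, Complex.exp_re]
    have him : (Complex.log (m z) * ((2 : ℕ)⁻¹ : ℂ)).im = Complex.arg (m z) / 2 := by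
      have : ((2 : ℕ)⁻¹ : ℂ) = ((2⁻¹ : ℝ) : ℂ) := by push_cast; rfl
      rw [this, Complex.im_mul_ofReal, Complex.log_im, div_eq_mul_inv]
    rw [him]
    exact mul_pos (Real.exp_pos _)
      (Real.cos_pos_of_mem_Ioo ⟨by linarith, by linarith⟩)

end Arcs

section Drawings

variable {V W P Q : Type*} {G : SimpleGraph V} {S : Set CrossingType} {X Y : Set V}

/-- The edges of `G` with both endpoints in `X`. -/
def edgesIn (G : SimpleGraph V) (X : Set V) : Set (Sym2 V) :=
  {e | e ∈ G.edgeSet ∧ ∀ v ∈ e, v ∈ X}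

theorem mk_mem_edgesIn {u v : V} : s(u, v) ∈ edgesIn G X ↔ G.Adj u v ∧ u ∈ X ∧ v ∈ X := by
  simp [edgesIn]

theorem edgesIn_mono (h : X ⊆ Y) : edgesIn G X ⊆ edgesIn G Y :=
  fun _ he => ⟨he.1, fun v hv => h (he.2 v hv)⟩

/-- `Drawing.Crosses` for a drawing of `G[X]` given by functions on all of `V`. -/
def CrossesOn (G : SimpleGraph V) (X : Set V) (pos : V → P) (arc : Sym2 V → Set P)
    (e e' : Sym2 V) (p : P) : Prop :=
  e ∈ edgesIn G X ∧ e' ∈ edgesIn G X ∧ e ≠ e' ∧ p ∈ arc e ∧ p ∈ arc e' ∧ p ∉ pos '' X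

/-- The functions `pos` and `arc` form an `S`-restricted drawing of `G[X]` in the space `P`. -/
structure IsRestrictedDrawingOn [TopologicalSpace P] (G : SimpleGraph V) (S : Set CrossingType)
    (X : Set V) (pos : V → P) (arc : Sym2 V → Set P) : Prop where
  injOn : Set.InjOn pos X
  isArcIn : ∀ u v : V, s(u, v) ∈ edgesIn G X → IsArcIn (arc s(u, v)) (pos u) (pos v)
  avoid : ∀ e ∈ edgesIn G X, ∀ w ∈ X, pos w ∈ arc e → w ∈ e
  unique : ∀ e e₁ e₂ p q, CrossesOn G X pos arc e e₁ p → CrossesOn G X pos arc e e₂ q →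
    e₁ = e₂ ∧ p = q
  not_mem : ∀ e e' p, CrossesOn G X pos arc e e' p → ∀ v ∈ e, v ∉ e'
  crossingType : ∀ a b c d p, CrossesOn G X pos arc s(a, b) s(c, d) p →
    ∃ t ∈ S, HasCrossingType G a b c d t

theorem hasCrossingType_of_adj_iff {H : SimpleGraph W} {f : W → V}
    (hf : ∀ a b, H.Adj a b ↔ G.Adj (f a) (f b)) (a b c d : W) (t : CrossingType) :
    HasCrossingType H a b c d t ↔ HasCrossingType G (f a) (f b) (f c) (f d) t := by
  cases t <;> simp only [HasCrossingType, hf]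

theorem map_mem_edgesIn_range {H : SimpleGraph W} {f : W → V}
    (hf : ∀ a b, H.Adj a b ↔ G.Adj (f a) (f b)) {e : Sym2 W} :
    e.map f ∈ edgesIn G (Set.range f) ↔ e ∈ H.edgeSet := by
  induction e with
  | _ a b => simp [mk_mem_edgesIn, hf]

theorem exists_map_eq_of_mem_edgesIn_range {f : W → V} {e : Sym2 V}
    (he : e ∈ edgesIn G (Set.range f)) : ∃ e' : Sym2 W, e'.map f = e := by
  induction e with
  | _ a b =>
    obtain ⟨-, ⟨a, rfl⟩, ⟨b, rfl⟩⟩ := mk_mem_edgesIn.1 he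
    exact ⟨s(a, b), rfl⟩

/-- Restricted drawings of a graph `H` are the same as restricted drawings on the range of
an embedding of `H` as an induced subgraph. -/
theorem sRestricted_iff_exists_isRestrictedDrawingOn {H : SimpleGraph W} {f : W → V}
    (hinj : Function.Injective f) (hf : ∀ a b, H.Adj a b ↔ G.Adj (f a) (f b)) :
    SRestricted H S ↔ ∃ (pos : V → ℝ × ℝ) (arc : Sym2 V → Set (ℝ × ℝ)),
      IsRestrictedDrawingOn G S (Set.range f) pos arc := by
  have hinj₂ : Function.Injective (Sym2.map f) := Sym2.map.injective hinj
  constructor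
  · rintro ⟨D, ⟨h1, h2⟩, h3⟩
    have hpos : ∀ w, Function.extend f D.pos 0 (f w) = D.pos w := hinj.extend_apply _ _
    have harc : ∀ e, Function.extend (Sym2.map f) D.arc (fun _ => ∅) (e.map f) = D.arc e :=
      hinj₂.extend_apply _ _
    have harc' : ∀ a b, Function.extend (Sym2.map f) D.arc (fun _ => ∅) s(f a, f b) =
      D.arc s(a, b) := fun a b => harc s(a, b)
    have hcr : ∀ e e' p, CrossesOn G (Set.range f) (Function.extend f D.pos 0)
        (Function.extend (Sym2.map f) D.arc (fun _ => ∅)) (e.map f) (e'.map f) p →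
        D.Crosses e e' p := by
      rintro e e' p ⟨he, he', hne, hp, hp', hp''⟩
      refine ⟨(map_mem_edgesIn_range hf).1 he, (map_mem_edgesIn_range hf).1 he',
        fun h => hne (h ▸ rfl), by rwa [harc] at hp, by rwa [harc] at hp', ?_⟩
      rintro ⟨w, rfl⟩
      exact hp'' ⟨f w, ⟨w, rfl⟩, hpos w⟩
    refine ⟨Function.extend f D.pos 0, Function.extend (Sym2.map f) D.arc fun _ => ∅,
      ?_, ?_, ?_, ?_, ?_, ?_⟩
    · rintro _ ⟨a, rfl⟩ _ ⟨b, rfl⟩ h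
      rw [hpos, hpos] at h
      rw [D.pos_inj h]
    · intro u v he
      obtain ⟨hadj, ⟨a, rfl⟩, ⟨b, rfl⟩⟩ := mk_mem_edgesIn.1 he
      rw [hpos, hpos, harc']
      exact D.arc_curve s(a, b) ((hf a b).2 hadj) a b rfl
    · rintro e he _ ⟨w, rfl⟩ hw
      obtain ⟨e, rfl⟩ := exists_map_eq_of_mem_edgesIn_range he
      rw [hpos, harc] at hw
      exact Sym2.mem_map.2 ⟨w, D.arc_avoid e ((map_mem_edgesIn_range hf).1 he) w hw, rfl⟩
    · intro e e₁ e₂ p q hp hq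
      obtain ⟨e, rfl⟩ := exists_map_eq_of_mem_edgesIn_range hp.1
      obtain ⟨e₁, rfl⟩ := exists_map_eq_of_mem_edgesIn_range hp.2.1
      obtain ⟨e₂, rfl⟩ := exists_map_eq_of_mem_edgesIn_range hq.2.1
      obtain ⟨h, h'⟩ := h1 e e₁ e₂ p q (hcr _ _ _ hp) (hcr _ _ _ hq)
      exact ⟨h ▸ rfl, h'⟩
    · intro e e' p hp v hv hv'
      obtain ⟨e, rfl⟩ := exists_map_eq_of_mem_edgesIn_range hp.1
      obtain ⟨e', rfl⟩ := exists_map_eq_of_mem_edgesIn_range hp.2.1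
      obtain ⟨a, ha, rfl⟩ := Sym2.mem_map.1 hv
      obtain ⟨b, hb, hab⟩ := Sym2.mem_map.1 hv'
      exact h2 e e' p (hcr _ _ _ hp) a ha (hinj hab ▸ hb)
    · intro a b c d p hp
      obtain ⟨-, ⟨a, rfl⟩, ⟨b, rfl⟩⟩ := mk_mem_edgesIn.1 hp.1
      obtain ⟨-, ⟨c, rfl⟩, ⟨d, rfl⟩⟩ := mk_mem_edgesIn.1 hp.2.1
      obtain ⟨t, ht, h⟩ := h3 a b c d p (hcr s(a, b) s(c, d) p hp)
      exact ⟨t, ht, (hasCrossingType_of_adj_iff hf a b c d t).1 h⟩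
  · rintro ⟨pos, arc, h⟩
    have hcr : ∀ e e' p, e ∈ H.edgeSet → e' ∈ H.edgeSet → e ≠ e' → p ∈ arc (e.map f) →
        p ∈ arc (e'.map f) → p ∉ Set.range (pos ∘ f) →
        CrossesOn G (Set.range f) pos arc (e.map f) (e'.map f) p :=
      fun e e' p he he' hne hp hp' hp'' => ⟨(map_mem_edgesIn_range hf).2 he,
        (map_mem_edgesIn_range hf).2 he', hinj₂.ne hne, hp, hp', by rwa [← Set.range_comp]⟩
    refine ⟨⟨pos ∘ f, fun a b hab => hinj (h.injOn ⟨a, rfl⟩ ⟨b, rfl⟩ hab),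
      fun e => arc (e.map f), ?_, ?_, ?_⟩, ⟨?_, ?_⟩, ?_⟩
    · rintro e he u v rfl
      exact h.isArcIn (f u) (f v) ((map_mem_edgesIn_range (e := s(u, v)) hf).2 he)
    · intro e he w hw
      obtain ⟨a, ha, hab⟩ := Sym2.mem_map.1
        (h.avoid _ ((map_mem_edgesIn_range hf).2 he) (f w) ⟨w, rfl⟩ hw)
      exact hinj hab ▸ ha
    · intro e he e' he' hne
      have hfin : (pos '' (e.map f : Set V)).Finite := by
        refine Set.Finite.image _ ?_
        induction e with
        | _ a b => simp
      have hsub : {p | CrossesOn G (Set.range f) pos arc (e.map f) (e'.map f) p}.Subsingleton :=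
        fun p hp q hq => (h.unique _ _ _ p q hp hq).2
      refine (hfin.union hsub.finite).subset ?_
      rintro p ⟨hp, hp'⟩
      by_cases hp'' : p ∈ Set.range (pos ∘ f)
      · left
        obtain ⟨w, rfl⟩ := hp''
        exact ⟨f w, h.avoid _ ((map_mem_edgesIn_range hf).2 he) (f w) ⟨w, rfl⟩ hp, rfl⟩
      · exact Or.inr (hcr e e' p he he' hne hp hp' hp'')
    · rintro e e₁ e₂ p q ⟨a1, a2, a3, a4, a5, a6⟩ ⟨b1, b2, b3, b4, b5, b6⟩
      obtain ⟨h1, h2⟩ := h.unique _ _ _ _ _ (hcr e e₁ p a1 a2 a3 a4 a5 a6)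
        (hcr e e₂ q b1 b2 b3 b4 b5 b6)
      exact ⟨hinj₂ h1, h2⟩
    · rintro e e' p ⟨a1, a2, a3, a4, a5, a6⟩ v hv hv'
      exact h.not_mem _ _ _ (hcr e e' p a1 a2 a3 a4 a5 a6) (f v) (Sym2.mem_map.2 ⟨v, hv, rfl⟩)
        (Sym2.mem_map.2 ⟨v, hv', rfl⟩)
    · rintro a b c d p ⟨a1, a2, a3, a4, a5, a6⟩
      obtain ⟨t, ht, hh⟩ := h.crossingType _ _ _ _ _ (hcr s(a, b) s(c, d) p a1 a2 a3 a4 a5 a6)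
      exact ⟨t, ht, (hasCrossingType_of_adj_iff hf a b c d t).2 hh⟩

variable [TopologicalSpace P] [TopologicalSpace Q]

/-- A modified drawing is restricted if each of its crossings comes from a crossing of the
original drawing. -/
theorem IsRestrictedDrawingOn.of_crossesOn {pos : V → P} {arc : Sym2 V → Set P}
    (h : IsRestrictedDrawingOn G S Y pos arc) {pos' : V → Q} {arc' : Sym2 V → Set Q}
    (hinj : Set.InjOn pos' X)
    (harc : ∀ u v : V, s(u, v) ∈ edgesIn G X → IsArcIn (arc' s(u, v)) (pos' u) (pos' v))
    (havoid : ∀ e ∈ edgesIn G X, ∀ w ∈ X, pos' w ∈ arc' e → w ∈ e) (φ : P → Q)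
    (hcr : ∀ e e' p, CrossesOn G X pos' arc' e e' p →
      ∃ q, CrossesOn G Y pos arc e e' q ∧ φ q = p) :
    IsRestrictedDrawingOn G S X pos' arc' where
  injOn := hinj
  isArcIn := harc
  avoid := havoid
  unique e e₁ e₂ p q hp hq := by
    obtain ⟨p, hp', rfl⟩ := hcr _ _ _ hp
    obtain ⟨q, hq', rfl⟩ := hcr _ _ _ hq
    obtain ⟨h1, h2⟩ := h.unique _ _ _ _ _ hp' hq'
    exact ⟨h1, congrArg φ h2⟩
  not_mem e e' p hp := by
    obtain ⟨p, hp', rfl⟩ := hcr _ _ _ hp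
    exact h.not_mem _ _ _ hp'
  crossingType a b c d p hp := by
    obtain ⟨p, hp', rfl⟩ := hcr _ _ _ hp
    exact h.crossingType _ _ _ _ _ hp'

theorem IsRestrictedDrawingOn.mono {pos : V → P} {arc : Sym2 V → Set P}
    (h : IsRestrictedDrawingOn G S Y pos arc) (hXY : X ⊆ Y) :
    IsRestrictedDrawingOn G S X pos arc := by
  refine h.of_crossesOn (h.injOn.mono hXY) (fun u v he => h.isArcIn u v (edgesIn_mono hXY he))
    (fun e he w hw => h.avoid e (edgesIn_mono hXY he) w (hXY hw)) id ?_
  rintro e e' p ⟨he, he', hne, hp, hp', hp''⟩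
  refine ⟨p, ⟨edgesIn_mono hXY he, edgesIn_mono hXY he', hne, hp, hp', ?_⟩, rfl⟩
  rintro ⟨w, hw, rfl⟩
  exact hp'' ⟨w, he.2 w (h.avoid e (edgesIn_mono hXY he) w hw hp), rfl⟩

/-- The image of a drawing under a continuous injection. -/
theorem IsRestrictedDrawingOn.image {pos : V → P} {arc : Sym2 V → Set P}
    (h : IsRestrictedDrawingOn G S X pos arc) {K : Set P} {φ : P → Q} (hφ : ContinuousOn φ K)
    (hi : Set.InjOn φ K) (hpos : ∀ v ∈ X, pos v ∈ K) (harc : ∀ e ∈ edgesIn G X, arc e ⊆ K) :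
    IsRestrictedDrawingOn G S X (φ ∘ pos) (fun e => φ '' arc e) := by
  refine h.of_crossesOn (hi.comp h.injOn hpos) (fun u v he => (h.isArcIn u v he).image
    (hφ.mono (harc _ he)) (hi.mono (harc _ he))) ?_ φ ?_
  · rintro e he w hw ⟨p, hp, hpw⟩
    exact h.avoid e he w hw (hi (harc e he hp) (hpos w hw) hpw ▸ hp)
  · rintro e e' _ ⟨he, he', hne, ⟨p, hp, rfl⟩, ⟨p', hp', hpp⟩, hp''⟩
    obtain rfl := hi (harc e' he' hp') (harc e he hp) hpp
    refine ⟨p', ⟨he, he', hne, hp, hp', ?_⟩, rfl⟩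
    rintro ⟨w, hw, rfl⟩
    exact hp'' ⟨w, hw, rfl⟩

/-- Two drawings which meet only in the image of at most one common vertex can be combined. -/
theorem IsRestrictedDrawingOn.union {pos₁ pos₂ : V → P} {arc₁ arc₂ : Sym2 V → Set P}
    (h₁ : IsRestrictedDrawingOn G S X pos₁ arc₁) (h₂ : IsRestrictedDrawingOn G S Y pos₂ arc₂)
    {K₁ K₂ : Set P} (hpos₁ : ∀ v ∈ X, pos₁ v ∈ K₁) (harc₁ : ∀ e ∈ edgesIn G X, arc₁ e ⊆ K₁)
    (hpos₂ : ∀ v ∈ Y, pos₂ v ∈ K₂) (harc₂ : ∀ e ∈ edgesIn G Y, arc₂ e ⊆ K₂)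
    (hXY : (X ∩ Y).Subsingleton)
    (hK : ∀ p ∈ K₁, p ∈ K₂ → ∃ v ∈ X ∩ Y, pos₁ v = p ∧ pos₂ v = p)
    (hagree : ∀ v ∈ X ∩ Y, pos₁ v = pos₂ v)
    (hedge : ∀ u ∈ X \ Y, ∀ v ∈ Y \ X, ¬ G.Adj u v) :
    ∃ (pos : V → P) (arc : Sym2 V → Set P), IsRestrictedDrawingOn G S (X ∪ Y) pos arc := by
  classical
  set pos : V → P := fun v => if v ∈ X then pos₁ v else pos₂ v with hpos
  set arc : Sym2 V → Set P := fun e => if e ∈ edgesIn G X then arc₁ e else arc₂ e with harc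
  have hp1 : ∀ v ∈ X, pos v = pos₁ v := fun v hv => if_pos hv
  have hp2 : ∀ v ∈ Y, pos v = pos₂ v := fun v hv => by
    by_cases hx : v ∈ X
    · rw [hp1 v hx, hagree v ⟨hx, hv⟩]
    · exact if_neg hx
  have hdisj : ∀ e, e ∈ edgesIn G X → e ∉ edgesIn G Y := by
    intro e he he'
    induction e with
    | _ a b =>
      rw [mk_mem_edgesIn] at he he'
      exact he.1.ne (hXY ⟨he.2.1, he'.2.1⟩ ⟨he.2.2, he'.2.2⟩)
  have ha1 : ∀ e ∈ edgesIn G X, arc e = arc₁ e := fun e he => if_pos he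
  have ha2 : ∀ e ∈ edgesIn G Y, arc e = arc₂ e := fun e he => if_neg fun h => hdisj e h he
  have hcases : ∀ e ∈ edgesIn G (X ∪ Y), e ∈ edgesIn G X ∨ e ∈ edgesIn G Y := by
    intro e he
    induction e with
    | _ a b =>
      simp only [mk_mem_edgesIn, Set.mem_union] at he ⊢
      have h1 := hedge a
      have h2 := fun ha hb (h : G.Adj a b) => hedge b ha a hb h.symm
      simp only [Set.mem_sdiff] at h1 h2
      have h1 := h1 (v := b)
      tauto
  have hcommon : ∀ x ∈ X, ∀ y ∈ Y, pos₁ x = pos₂ y → x = y := by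
    intro x hx y hy hxy
    obtain ⟨v, hv, h1, h2⟩ := hK _ (hpos₁ x hx) (hxy ▸ hpos₂ y hy)
    rw [← h₁.injOn hv.1 hx h1]
    exact h₂.injOn hv.2 hy (h2.trans hxy)
  have hK' : ∀ p ∈ K₁, p ∈ K₂ → p ∈ pos '' (X ∪ Y) := by
    intro p h1 h2
    obtain ⟨v, hv, rfl, -⟩ := hK p h1 h2
    exact ⟨v, Or.inl hv.1, hp1 v hv.1⟩
  have hcr : ∀ e e' p, CrossesOn G (X ∪ Y) pos arc e e' p →
      CrossesOn G X pos₁ arc₁ e e' p ∨ CrossesOn G Y pos₂ arc₂ e e' p := by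
    rintro e e' p ⟨he, he', hne, hp, hp', hp''⟩
    have hpX : p ∉ pos₁ '' X := by
      rintro ⟨w, hw, rfl⟩
      exact hp'' ⟨w, Or.inl hw, hp1 w hw⟩
    have hpY : p ∉ pos₂ '' Y := by
      rintro ⟨w, hw, rfl⟩
      exact hp'' ⟨w, Or.inr hw, hp2 w hw⟩
    rcases hcases e he with he | he <;> rcases hcases e' he' with he' | he'
    · rw [ha1 _ he] at hp
      rw [ha1 _ he'] at hp'
      exact Or.inl ⟨he, he', hne, hp, hp', hpX⟩
    · rw [ha1 _ he] at hp
      rw [ha2 _ he'] at hp'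
      exact absurd (hK' p (harc₁ _ he hp) (harc₂ _ he' hp')) hp''
    · rw [ha2 _ he] at hp
      rw [ha1 _ he'] at hp'
      exact absurd (hK' p (harc₁ _ he' hp') (harc₂ _ he hp)) hp''
    · rw [ha2 _ he] at hp
      rw [ha2 _ he'] at hp'
      exact Or.inr ⟨he, he', hne, hp, hp', hpY⟩
  refine ⟨pos, arc, ?_, ?_, ?_, ?_, ?_, ?_⟩
  · rintro u (hu | hu) v (hv | hv) huv
    · rw [hp1 u hu, hp1 v hv] at huv
      exact h₁.injOn hu hv huv
    · rw [hp1 u hu, hp2 v hv] at huv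
      exact hcommon u hu v hv huv
    · rw [hp2 u hu, hp1 v hv] at huv
      exact (hcommon v hv u hu huv.symm).symm
    · rw [hp2 u hu, hp2 v hv] at huv
      exact h₂.injOn hu hv huv
  · intro u v he
    rcases hcases _ he with he | he
    · rw [ha1 _ he, hp1 u (mk_mem_edgesIn.1 he).2.1, hp1 v (mk_mem_edgesIn.1 he).2.2]
      exact h₁.isArcIn u v he
    · rw [ha2 _ he, hp2 u (mk_mem_edgesIn.1 he).2.1, hp2 v (mk_mem_edgesIn.1 he).2.2]
      exact h₂.isArcIn u v he
  · rintro e he w hw hwe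
    rcases hcases _ he with he | he <;> rcases hw with hw | hw
    · rw [ha1 _ he, hp1 w hw] at hwe
      exact h₁.avoid e he w hw hwe
    · rw [ha1 _ he, hp2 w hw] at hwe
      obtain ⟨v, hv, h1, h2⟩ := hK _ (harc₁ e he hwe) (hpos₂ w hw)
      obtain rfl := h₂.injOn hv.2 hw h2
      exact h₁.avoid e he v hv.1 (h1 ▸ hwe)
    · rw [ha2 _ he, hp1 w hw] at hwe
      obtain ⟨v, hv, h1, h2⟩ := hK _ (hpos₁ w hw) (harc₂ e he hwe)
      obtain rfl := h₁.injOn hv.1 hw h1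
      exact h₂.avoid e he v hv.2 (h2 ▸ hwe)
    · rw [ha2 _ he, hp2 w hw] at hwe
      exact h₂.avoid e he w hw hwe
  · intro e e₁ e₂ p q hp hq
    rcases hcr _ _ _ hp with hp | hp <;> rcases hcr _ _ _ hq with hq | hq
    · exact h₁.unique _ _ _ _ _ hp hq
    · exact absurd hq.1 (hdisj e hp.1)
    · exact absurd hp.1 (hdisj e hq.1)
    · exact h₂.unique _ _ _ _ _ hp hq
  · intro e e' p hp
    rcases hcr _ _ _ hp with hp | hp
    · exact h₁.not_mem _ _ _ hp
    · exact h₂.not_mem _ _ _ hp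
  · intro a b c d p hp
    rcases hcr _ _ _ hp with hp | hp
    · exact h₁.crossingType _ _ _ _ _ hp
    · exact h₂.crossingType _ _ _ _ _ hp

theorem eq_center_of_mem_segments {c q q' p : ℂ} {r : ℝ} (hq : dist q c = r)
    (hq' : dist q' c = r) (hr : 0 < r) (hne : q ≠ q') (hp : p ∈ segment ℝ c q)
    (hp' : p ∈ segment ℝ c q') : p = c := by
  rw [segment_eq_image'] at hp hp'
  obtain ⟨s, hs, rfl⟩ := hp
  obtain ⟨t, ht, hst⟩ := hp'
  have hst : t • (q' - c) = s • (q - c) := add_left_cancel hst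
  have hn := congrArg norm hst
  rw [norm_smul, norm_smul, ← dist_eq_norm, ← dist_eq_norm, hq, hq', Real.norm_of_nonneg hs.1,
    Real.norm_of_nonneg ht.1] at hn
  obtain rfl := mul_right_cancel₀ hr.ne' hn
  have : t • (q' - q) = 0 := by
    rw [← sub_eq_zero.2 hst, ← smul_sub, sub_sub_sub_cancel_right]
  have ht0 : t = 0 := (smul_eq_zero.1 this).resolve_right (sub_ne_zero.2 hne.symm)
  simp [ht0]

/-- A drawing can be changed so that a given vertex is joined to some other point by a segment
avoiding the rest of the drawing. -/
theorem IsRestrictedDrawingOn.exists_free_segment [Finite V] {pos : V → ℂ} {arc : Sym2 V → Set ℂ}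
    (h : IsRestrictedDrawingOn G S X pos arc) {v : V} (hv : v ∈ X) :
    ∃ (arc' : Sym2 V → Set ℂ) (q : ℂ), IsRestrictedDrawingOn G S X pos arc' ∧ q ≠ pos v ∧
      (∀ w ∈ X, pos w ∈ segment ℝ (pos v) q → pos w = pos v) ∧
      ∀ e ∈ edgesIn G X, ∀ p ∈ arc' e, p ∈ segment ℝ (pos v) q → p = pos v := by
  classical
  set c := pos v with hc
  have hcompact : ∀ e ∈ edgesIn G X, IsCompact (arc e) := by
    intro e he
    induction e with
    | _ a b => exact (h.isArcIn a b he).isCompact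
  obtain ⟨r, hr, hrpos, hrarc⟩ : ∃ r > 0, (∀ w ∈ X, w ≠ v → r < dist (pos w) c) ∧
      ∀ e ∈ edgesIn G X, v ∉ e → ∀ p ∈ arc e, r < dist p c := by
    have hclosed : IsClosed (pos '' (X \ {v}) ∪
        ⋃ e ∈ {e | e ∈ edgesIn G X ∧ v ∉ e}, arc e) :=
      ((Set.toFinite _).isClosed).union
        ((Set.toFinite _).isClosed_biUnion fun e he => (hcompact e he.1).isClosed)
    have hmem : c ∈ (pos '' (X \ {v}) ∪ ⋃ e ∈ {e | e ∈ edgesIn G X ∧ v ∉ e}, arc e)ᶜ := by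
      rintro (⟨w, ⟨hw, hwv⟩, hwc⟩ | hce)
      · exact hwv (h.injOn hw hv hwc)
      · obtain ⟨e, ⟨he, hve⟩, hce⟩ := Set.mem_iUnion₂.1 hce
        exact hve (h.avoid e he v hv hce)
    obtain ⟨r, hr, hsub⟩ := Metric.nhds_basis_closedBall.mem_iff.1
      (hclosed.isOpen_compl.mem_nhds hmem)
    refine ⟨r, hr, fun w hw hwv => ?_, fun e he hve p hp => ?_⟩
    · by_contra! hle
      exact hsub (Metric.mem_closedBall.2 hle) (Or.inl ⟨w, ⟨hw, hwv⟩, rfl⟩)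
    · by_contra! hle
      exact hsub (Metric.mem_closedBall.2 hle)
        (Or.inr (Set.mem_iUnion₂.2 ⟨e, ⟨he, hve⟩, hp⟩))
  have hex : ∀ e : Sym2 V, ∃ (A : Set ℂ) (q : ℂ), e ∈ edgesIn G X → v ∈ e →
      (∀ w, e = s(v, w) → IsArcIn A c (pos w)) ∧ dist q c = r ∧ q ∈ arc e ∧
      A ⊆ segment ℝ c q ∪ {p ∈ arc e | r < dist p c} := by
    intro e
    by_cases he : e ∈ edgesIn G X ∧ v ∈ e
    · obtain ⟨he, w, rfl⟩ := he
      obtain ⟨hadj, -, hw⟩ := mk_mem_edgesIn.1 he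
      obtain ⟨A, q, h1, h2, h3, h4⟩ := (h.isArcIn v w he).exists_radial hr
        (hrpos w hw hadj.ne')
      refine ⟨A, q, fun _ _ => ⟨fun w' hw' => ?_, h2, h3, h4⟩⟩
      rwa [← Sym2.congr_right.1 hw']
    · exact ⟨∅, 0, fun h1 h2 => absurd ⟨h1, h2⟩ he⟩
  choose A q hAq using hex
  set arc' : Sym2 V → Set ℂ := fun e => if v ∈ e then A e else arc e with harc'
  have ha1 : ∀ e, v ∈ e → arc' e = A e := fun e he => if_pos he
  have ha2 : ∀ e, v ∉ e → arc' e = arc e := fun e he => if_neg he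
  have hball : ∀ x : ℂ, dist x c = r → ∀ p ∈ segment ℝ c x, dist p c ≤ r := fun x hx p hp =>
    (convex_closedBall c r).segment_subset (Metric.mem_closedBall_self hr.le)
      (Metric.mem_closedBall.2 hx.le) hp
  have hout : ∀ e ∈ edgesIn G X, ∀ p ∈ arc' e, r < dist p c → p ∈ arc e := by
    intro e he p hp hrp
    by_cases hve : v ∈ e
    · obtain ⟨-, h2, -, h4⟩ := hAq e he hve
      rw [ha1 e hve] at hp
      rcases h4 hp with hp | hp
      · exact absurd hrp (not_lt.2 (hball _ h2 p hp))
      · exact hp.1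
    · rwa [ha2 e hve] at hp
  have hin : ∀ e ∈ edgesIn G X, ∀ p ∈ arc' e, dist p c ≤ r → v ∈ e ∧ p ∈ segment ℝ c (q e) := by
    intro e he p hp hrp
    by_cases hve : v ∈ e
    · obtain ⟨-, h2, -, h4⟩ := hAq e he hve
      rw [ha1 e hve] at hp
      rcases h4 hp with hp | hp
      · exact ⟨hve, hp⟩
      · exact absurd hp.2 (not_lt.2 hrp)
    · rw [ha2 e hve] at hp
      exact absurd (hrarc e he hve p hp) (not_lt.2 hrp)
  have hq : ∀ e ∈ edgesIn G X, ∀ e' ∈ edgesIn G X, v ∈ e → v ∈ e' → e ≠ e' → q e ≠ q e' := by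
    intro e he e' he' hve hve' hne heq
    obtain ⟨-, h2, h3, -⟩ := hAq e he hve
    obtain ⟨-, -, h3', -⟩ := hAq e' he' hve'
    refine h.not_mem e e' (q e) ⟨he, he', hne, h3, heq ▸ h3', ?_⟩ v hve hve'
    rintro ⟨w, hw, hwq⟩
    rw [← hwq] at h2
    by_cases hwv : w = v
    · rw [hwv, ← hc, dist_self] at h2
      exact hr.ne h2
    · exact (hrpos w hw hwv).ne' h2
  obtain ⟨z, hz, hzq⟩ : ∃ z ∈ Metric.sphere c r, z ∉ Set.range q := by
    have hinf : (Metric.sphere c r).Infinite := by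
      refine (isPreconnected_sphere (by simp) c r).infinite_of_nontrivial
        ⟨c + r, ?_, c - r, ?_, ?_⟩
      · simp [abs_of_pos hr]
      · simp [abs_of_pos hr]
      · intro heq
        have : (2 * r : ℂ) = 0 := by linear_combination heq
        have h2 : (r : ℂ) = 0 := by simpa using this
        exact hr.ne' (Complex.ofReal_eq_zero.1 h2)
    exact hinf.exists_notMem_finite (Set.finite_range q)
  refine ⟨arc', z, ?_, ?_, ?_, ?_⟩
  · refine h.of_crossesOn h.injOn ?_ ?_ id ?_
    · intro a b he
      by_cases hve : v ∈ s(a, b)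
      · rw [ha1 _ hve]
        obtain ⟨h1, -⟩ := hAq _ he hve
        rcases Sym2.mem_iff.1 hve with rfl | rfl
        · exact h1 b rfl
        · exact (h1 a Sym2.eq_swap).symm
      · rw [ha2 _ hve]
        exact h.isArcIn a b he
    · intro e he w hw hwe
      by_cases hwv : w = v
      · subst hwv
        exact (hin e he _ hwe (by simp [← hc, hr.le])).1
      · exact h.avoid e he w hw (hout e he _ hwe (hrpos w hw hwv))
    · rintro e e' p ⟨he, he', hne, hp, hp', hp''⟩
      rcases lt_or_ge r (dist p c) with hrp | hrp
      · exact ⟨p, ⟨he, he', hne, hout e he p hp hrp, hout e' he' p hp' hrp, hp''⟩, rfl⟩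
      · obtain ⟨hve, hpe⟩ := hin e he p hp hrp
        obtain ⟨hve', hpe'⟩ := hin e' he' p hp' hrp
        exact absurd ⟨v, hv, (eq_center_of_mem_segments (hAq e he hve).2.1 (hAq e' he' hve').2.1
          hr (hq e he e' he' hve hve' hne) hpe hpe').symm⟩ hp''
  · rintro rfl
    simp [hr.ne] at hz
  · intro w hw hwz
    by_contra hwc
    have hwv : w ≠ v := fun h => hwc (h ▸ rfl)
    exact absurd (hrpos w hw hwv) (not_lt.2 (hball z hz _ hwz))
  · intro e he p hp hpz
    obtain ⟨hve, hpe⟩ := hin e he p hp (hball z hz p hpz)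
    exact eq_center_of_mem_segments (hAq e he hve).2.1 hz hr (fun h => hzq ⟨e, h⟩) hpe hpz

/-- `G[X]` has an `S`-restricted drawing in the complex plane. -/
def IsRestrictedOn (G : SimpleGraph V) (S : Set CrossingType) (X : Set V) : Prop :=
  ∃ (pos : V → ℂ) (arc : Sym2 V → Set ℂ), IsRestrictedDrawingOn G S X pos arc

theorem IsRestrictedOn.mono (h : IsRestrictedOn G S Y) (hXY : X ⊆ Y) : IsRestrictedOn G S X := by
  obtain ⟨pos, arc, h⟩ := h
  exact ⟨pos, arc, h.mono hXY⟩

theorem sRestricted_iff_isRestrictedOn {H : SimpleGraph W} {f : W → V}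
    (hinj : Function.Injective f) (hf : ∀ a b, H.Adj a b ↔ G.Adj (f a) (f b)) :
    SRestricted H S ↔ IsRestrictedOn G S (Set.range f) := by
  rw [sRestricted_iff_exists_isRestrictedDrawingOn hinj hf]
  constructor
  · rintro ⟨pos, arc, h⟩
    exact ⟨_, _, h.image (φ := Complex.equivRealProdCLM.symm) (K := Set.univ)
      Complex.equivRealProdCLM.symm.continuous.continuousOn
      Complex.equivRealProdCLM.symm.injective.injOn (by simp) (by simp)⟩
  · rintro ⟨pos, arc, h⟩
    exact ⟨_, _, h.image (φ := Complex.equivRealProdCLM) (K := Set.univ)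
      Complex.equivRealProdCLM.continuous.continuousOn
      Complex.equivRealProdCLM.injective.injOn (by simp) (by simp)⟩

theorem isRestrictedOn_empty : IsRestrictedOn G S ∅ := by
  have he : ∀ e, e ∉ edgesIn G (∅ : Set V) := by
    intro e he
    induction e with
    | _ a b => simp [mk_mem_edgesIn] at he
  exact ⟨fun _ => 0, fun _ => ∅, by simp, fun _ _ h => absurd h (he _),
    fun _ h => absurd h (he _), fun _ _ _ _ _ h => absurd h.1 (he _),
    fun _ _ _ h => absurd h.1 (he _), fun _ _ _ _ _ h => absurd h.1 (he _)⟩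

/-- A drawing can be moved into the right half plane with a given vertex on the boundary. -/
theorem IsRestrictedOn.exists_halfPlane [Finite V] (h : IsRestrictedOn G S X) {v : V}
    (hv : v ∈ X) : ∃ (pos : V → ℂ) (arc : Sym2 V → Set ℂ), IsRestrictedDrawingOn G S X pos arc ∧
      pos v = 0 ∧ (∀ w ∈ X, pos w ∈ {z : ℂ | z = 0 ∨ 0 < z.re}) ∧
      ∀ e ∈ edgesIn G X, arc e ⊆ {z : ℂ | z = 0 ∨ 0 < z.re} := by
  obtain ⟨pos, arc, h⟩ := h
  obtain ⟨arc, q, h, hq, hpos, harc⟩ := h.exists_free_segment hv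
  obtain ⟨φ, hφ, hinj, h0, hre⟩ := exists_map_slit_halfPlane hq
  have key : ∀ z, (z ∈ segment ℝ (pos v) q → z = pos v) → φ z = 0 ∨ 0 < (φ z).re := by
    intro z hz
    by_cases hzc : z = pos v
    · exact Or.inl (hzc ▸ h0)
    · exact Or.inr (hre z hz hzc)
  refine ⟨_, _, h.image hφ hinj hpos harc, h0, fun w hw => key _ (hpos w hw), ?_⟩
  rintro e he _ ⟨p, hp, rfl⟩
  exact key p (harc e he p hp)

theorem IsRestrictedOn.union_of_inter_eq_singleton [Finite V] (hX : IsRestrictedOn G S X)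
    (hY : IsRestrictedOn G S Y) {v : V} (hXY : X ∩ Y = {v})
    (hedge : ∀ u ∈ X \ Y, ∀ w ∈ Y \ X, ¬ G.Adj u w) : IsRestrictedOn G S (X ∪ Y) := by
  have hv : v ∈ X ∩ Y := hXY ▸ Set.mem_singleton v
  obtain ⟨pos₁, arc₁, h₁, hv₁, hp₁, ha₁⟩ := hX.exists_halfPlane hv.1
  obtain ⟨pos₂, arc₂, h₂, hv₂, hp₂, ha₂⟩ := hY.exists_halfPlane hv.2
  have hneg := h₂.image (φ := fun z => -z) (K := Set.univ) continuous_neg.continuousOn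
    neg_injective.injOn (by simp) (by simp)
  refine h₁.union hneg (K₂ := {z : ℂ | z = 0 ∨ z.re < 0}) hp₁ ha₁ ?_ ?_ ?_ ?_ ?_ hedge
  · intro w hw
    simpa using hp₂ w hw
  · rintro e he _ ⟨p, hp, rfl⟩
    simpa using ha₂ e he hp
  · rw [hXY]
    exact Set.subsingleton_singleton
  · intro p hp hp'
    have h0 : p = 0 := by
      rcases hp with hp | hp
      · exact hp
      · exact hp'.resolve_right (not_lt.2 hp.le)
    exact ⟨v, hv, by simp [hv₁, h0], by simp [hv₂, h0]⟩
  · intro w hw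
    rw [hXY] at hw
    obtain rfl := hw
    simp [hv₁, hv₂]

theorem IsRestrictedOn.union_of_disjoint [Finite V] (hX : IsRestrictedOn G S X)
    (hY : IsRestrictedOn G S Y) (hXY : Disjoint X Y) (hedge : ∀ u ∈ X, ∀ w ∈ Y, ¬ G.Adj u w) :
    IsRestrictedOn G S (X ∪ Y) := by
  rcases X.eq_empty_or_nonempty with rfl | ⟨x, hx⟩
  · rwa [Set.empty_union]
  rcases Y.eq_empty_or_nonempty with rfl | ⟨y, hy⟩
  · rwa [Set.union_empty]
  obtain ⟨pos₁, arc₁, h₁, -, hp₁, ha₁⟩ := hX.exists_halfPlane hx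
  obtain ⟨pos₂, arc₂, h₂, -, hp₂, ha₂⟩ := hY.exists_halfPlane hy
  have h₁ := h₁.image (φ := fun z => z + 1) (K := Set.univ) (by fun_prop)
    (add_left_injective 1).injOn (by simp) (by simp)
  have h₂ := h₂.image (φ := fun z => -(z + 1)) (K := Set.univ) (by fun_prop)
    (neg_injective.comp (add_left_injective 1)).injOn (by simp) (by simp)
  have hre : ∀ z : ℂ, z = 0 ∨ 0 < z.re → 0 < (z + 1).re := by
    rintro z (rfl | hz)
    · simp
    · simpa using by linarith
  have hre' : ∀ z : ℂ, z = 0 ∨ 0 < z.re → (-(z + 1)).re < 0 := by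
    intro z hz
    rw [Complex.neg_re]
    linarith [hre z hz]
  refine h₁.union h₂ (K₁ := {z : ℂ | 0 < z.re}) (K₂ := {z : ℂ | z.re < 0})
    (fun w hw => hre _ (hp₁ w hw)) ?_ (fun w hw => hre' _ (hp₂ w hw)) ?_ ?_ ?_ ?_
    fun u hu w hw => hedge u hu.1 w hw.1
  · rintro e he _ ⟨p, hp, rfl⟩
    exact hre p (ha₁ e he hp)
  · rintro e he _ ⟨p, hp, rfl⟩
    exact hre' p (ha₂ e he hp)
  · rw [hXY.inter_eq]
    exact Set.subsingleton_empty
  · intro p hp hp'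
    exact absurd (Set.mem_ofPred.1 hp) (not_lt.2 (Set.mem_ofPred.1 hp').le)
  · intro w hw
    rw [hXY.inter_eq] at hw
    exact hw.elim

end Drawings

section Blocks

variable {V : Type*} {G : SimpleGraph V} {S : Set CrossingType}

/-- A nonempty vertex set inducing a connected subgraph without a cutvertex. -/
def IsNonseparable (G : SimpleGraph V) (B : Set V) : Prop :=
  B.Nonempty ∧ (G.induce B).Preconnected ∧ ∀ v : V, (G.induce (B \ {v})).Preconnected

theorem IsNonseparable.exists_isBlock [Finite V] {B : Set V} (hB : IsNonseparable G B) :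
    ∃ C, B ⊆ C ∧ IsBlock G C := by
  obtain ⟨C, hBC, hC⟩ := (Set.toFinite {C | IsNonseparable G C}).exists_le_maximal hB
  exact ⟨C, hBC, hC.prop.1, hC.prop.2.1, hC.prop.2.2,
    fun D hCD h1 h2 h3 => hC.eq_of_subset ⟨h1, h2, h3⟩ hCD⟩

theorem exists_partition_of_not_preconnected {Y : Set V} (hY : ¬ (G.induce Y).Preconnected) :
    ∃ A B : Set V, A ∪ B = Y ∧ Disjoint A B ∧ A.Nonempty ∧ B.Nonempty ∧
      ∀ u ∈ A, ∀ w ∈ B, ¬ G.Adj u w := by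
  simp only [SimpleGraph.Preconnected, not_forall] at hY
  obtain ⟨a, b, hab⟩ := hY
  refine ⟨(↑) '' {y : Y | (G.induce Y).Reachable a y},
    (↑) '' {y : Y | (G.induce Y).Reachable a y}ᶜ,
    ?_, ?_, ⟨a, a, SimpleGraph.Reachable.refl a, rfl⟩, ⟨b, b, hab, rfl⟩, ?_⟩
  · rw [← Set.image_union, Set.union_compl_self, Set.image_univ, Subtype.range_coe]
  · exact (Set.disjoint_image_iff Subtype.coe_injective).2 disjoint_compl_right
  · rintro _ ⟨u, hu, rfl⟩ _ ⟨w, hw, rfl⟩ huw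
    have : (G.induce Y).Adj u w := huw
    exact hw (SimpleGraph.Reachable.trans hu this.reachable)

theorem isRestrictedOn_of_forall_isNonseparable [Finite V]
    (h : ∀ B, IsNonseparable G B → IsRestrictedOn G S B) (X : Set V) : IsRestrictedOn G S X := by
  induction X using WellFoundedLT.induction with
  | _ X ih =>
    have hdisj : ∀ A B : Set V, A ∪ B = X → Disjoint A B → A.Nonempty → B.Nonempty →
        (∀ u ∈ A, ∀ w ∈ B, ¬ G.Adj u w) → IsRestrictedOn G S X := by
      rintro A B rfl hAB ⟨a, ha⟩ ⟨b, hb⟩ hedge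
      refine (ih A ?_).union_of_disjoint (ih B ?_) hAB hedge
      · exact Set.ssubset_iff_exists.2 ⟨Set.subset_union_left, b, Or.inr hb,
          fun hb' => hAB.le_bot ⟨hb', hb⟩⟩
      · exact Set.ssubset_iff_exists.2 ⟨Set.subset_union_right, a, Or.inl ha,
          fun ha' => hAB.le_bot ⟨ha, ha'⟩⟩
    rcases X.eq_empty_or_nonempty with rfl | hne
    · exact isRestrictedOn_empty
    by_cases hX : (G.induce X).Preconnected
    swap
    · obtain ⟨A, B, h1, h2, h3, h4, h5⟩ := exists_partition_of_not_preconnected hX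
      exact hdisj A B h1 h2 h3 h4 h5
    by_cases hX' : ∀ v : V, (G.induce (X \ {v})).Preconnected
    · exact h X ⟨hne, hX, hX'⟩
    push Not at hX'
    obtain ⟨v, hv⟩ := hX'
    obtain ⟨A, B, h1, h2, h3, h4, h5⟩ := exists_partition_of_not_preconnected hv
    by_cases hvX : v ∈ X
    swap
    · exact hdisj A B (h1.trans (Set.sdiff_singleton_eq_self hvX)) h2 h3 h4 h5
    have hvAB : v ∉ A ∪ B := fun hv => (h1 ▸ hv : v ∈ X \ {v}).2 rfl
    have hvA : v ∉ A := fun h => hvAB (Or.inl h)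
    have hvB : v ∉ B := fun h => hvAB (Or.inr h)
    obtain rfl : insert v A ∪ insert v B = X := by
      rw [Set.insert_union, Set.union_insert, Set.insert_idem, h1, Set.insert_sdiff_singleton,
        Set.insert_eq_of_mem hvX]
    obtain ⟨a, ha⟩ := h3
    obtain ⟨b, hb⟩ := h4
    refine (ih _ ?_).union_of_inter_eq_singleton (v := v) (ih _ ?_) ?_ ?_
    · refine Set.ssubset_iff_exists.2 ⟨Set.subset_union_left, b, by simp [hb], ?_⟩
      rintro (rfl | hb')
      · exact hvB hb
      · exact h2.le_bot ⟨hb', hb⟩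
    · refine Set.ssubset_iff_exists.2 ⟨Set.subset_union_right, a, by simp [ha], ?_⟩
      rintro (rfl | ha')
      · exact hvA ha
      · exact h2.le_bot ⟨ha, ha'⟩
    · rw [← Set.insert_inter_distrib, h2.inter_eq]
      simp
    · rintro u ⟨hu, hu'⟩ w ⟨hw, hw'⟩
      refine h5 u (hu.resolve_left ?_) w (hw.resolve_left ?_)
      · rintro rfl
        exact hu' (Set.mem_insert _ _)
      · rintro rfl
        exact hw' (Set.mem_insert _ _)

end Blocks

/-- **Reduction to blocks.** For every nonempty set `S` of crossing types, a (finite) graph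
is `S`-restricted if and only if all of its 2-connected components (blocks) are
`S`-restricted. -/
theorem srestricted_iff_blocks {V : Type*} [Fintype V] (G : SimpleGraph V)
    (S : Set CrossingType) (hS : S.Nonempty) :
    SRestricted G S ↔ ∀ B : Set V, IsBlock G B → SRestricted (G.induce B) S := by
  have hG : SRestricted G S ↔ IsRestrictedOn G S Set.univ := by
    rw [← Set.range_id]
    exact sRestricted_iff_isRestrictedOn Function.injective_id fun _ _ => Iff.rfl
  have hind : ∀ B : Set V, SRestricted (G.induce B) S ↔ IsRestrictedOn G S B := fun B => by
    have := sRestricted_iff_isRestrictedOn (G := G) (H := G.induce B) (S := S)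
      (f := ((↑) : B → V)) Subtype.coe_injective fun _ _ => Iff.rfl
    rwa [Subtype.range_coe] at this
  simp only [hG, hind]
  refine ⟨fun h B _ => h.mono (Set.subset_univ B), fun h => ?_⟩
  refine isRestrictedOn_of_forall_isNonseparable (fun B hB => ?_) _
  obtain ⟨C, hBC, hC⟩ := hB.exists_isBlock
  exact (h C hC).mono hBC

end OnePlanarity
end

section
/- Assume S ⊆ {full, almost-full, bowtie}. A graph G is S-restricted if and only if there is an S-restricted drawing of G in which no edge incident to a degree-two vertex is crossed. -/
open scoped unitInterval

namespace OnePlanarity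

open Set Metric

theorem IsArc.exists_real {A : Set (ℝ × ℝ)} {x y : ℝ × ℝ} (h : IsArc A x y) :
    ∃ f : ℝ → ℝ × ℝ, Continuous f ∧ InjOn f (Icc 0 1) ∧ f 0 = x ∧ f 1 = y ∧
      f '' Icc 0 1 = A := by
  obtain ⟨g, hg, hinj, h0, h1, rfl⟩ := h
  refine ⟨fun t => g (projIcc 0 1 zero_le_one t), hg.comp continuous_projIcc, ?_, ?_, ?_, ?_⟩
  · intro s hs t ht hst
    have := hinj hst
    rw [projIcc_of_mem _ hs, projIcc_of_mem _ ht] at this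
    exact congrArg Subtype.val this
  · simpa using h0
  · simpa using h1
  · ext z
    constructor
    · rintro ⟨t, -, rfl⟩
      exact mem_range_self _
    · rintro ⟨t, rfl⟩
      exact ⟨t, t.2, by simp⟩

theorem isArc_image_Icc {f : ℝ → ℝ × ℝ} {a b : ℝ} (hab : a < b)
    (hf : ContinuousOn f (Icc a b)) (hinj : InjOn f (Icc a b)) :
    IsArc (f '' Icc a b) (f a) (f b) := by
  have hba : 0 < b - a := sub_pos.2 hab
  have hmem : ∀ t : I, a + t * (b - a) ∈ Icc a b := fun t =>
    ⟨by nlinarith [t.2.1], by nlinarith [t.2.2]⟩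
  refine ⟨fun t => f (a + t * (b - a)), ?_, ?_, by simp, by simp, ?_⟩
  · exact hf.comp_continuous (by fun_prop) hmem
  · intro s t hst
    have := hinj (hmem s) (hmem t) hst
    have h2 : (s : ℝ) * (b - a) = t * (b - a) := by linarith
    exact Subtype.ext (mul_right_cancel₀ hba.ne' h2)
  · ext z
    constructor
    · rintro ⟨t, rfl⟩
      exact ⟨_, hmem t, rfl⟩
    · rintro ⟨t, ht, rfl⟩
      refine ⟨⟨(t - a) / (b - a), div_nonneg (by linarith [ht.1]) hba.le,
        (div_le_one hba).2 (by linarith [ht.2])⟩, ?_⟩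
      have : a + (t - a) / (b - a) * (b - a) = t := by
        rw [div_mul_cancel₀ _ hba.ne']
        ring
      exact congrArg f this

namespace IsArc

variable {A B : Set (ℝ × ℝ)} {x y z : ℝ × ℝ}

theorem isCompact (h : IsArc A x y) : IsCompact A := by
  obtain ⟨f, hf, -, -, -, rfl⟩ := h
  exact isCompact_range hf

theorem left_mem (h : IsArc A x y) : x ∈ A := by
  obtain ⟨f, -, -, rfl, -, rfl⟩ := h
  exact mem_range_self _

theorem right_mem (h : IsArc A x y) : y ∈ A := by
  obtain ⟨f, -, -, -, rfl, rfl⟩ := h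
  exact mem_range_self _

theorem symm (h : IsArc A x y) : IsArc A y x := by
  obtain ⟨f, hf, hinj, h0, h1, rfl⟩ := h
  refine ⟨fun t => f (unitInterval.symm t), hf.comp unitInterval.continuous_symm,
    hinj.comp unitInterval.symm_bijective.injective, by simpa, by simpa, ?_⟩
  exact unitInterval.symm_bijective.surjective.range_comp f

theorem image (h : IsArc A x y) (g : (ℝ × ℝ) ≃ₜ (ℝ × ℝ)) : IsArc (g '' A) (g x) (g y) := by
  obtain ⟨f, hf, hinj, rfl, rfl, rfl⟩ := h
  exact ⟨g ∘ f, g.continuous.comp hf, g.injective.comp hinj, rfl, rfl, range_comp g f⟩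

theorem isPreconnected_diff (h : IsArc A x y) : IsPreconnected (A \ {x, y}) := by
  obtain ⟨f, hf, hinj, rfl, rfl, rfl⟩ := h.exists_real
  have h0 : (0 : ℝ) ∈ Icc (0 : ℝ) 1 := by simp
  have h1 : (1 : ℝ) ∈ Icc (0 : ℝ) 1 := by simp
  have : f '' Icc 0 1 \ {f 0, f 1} = f '' Ioo 0 1 := by
    ext z
    constructor
    · rintro ⟨⟨t, ht, rfl⟩, hz⟩
      simp only [mem_insert_iff, mem_singleton_iff, not_or] at hz
      exact ⟨t, ⟨lt_of_le_of_ne ht.1 fun h => hz.1 (by rw [h]),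
        lt_of_le_of_ne ht.2 fun h => hz.2 (by rw [h])⟩, rfl⟩
    · rintro ⟨t, ht, rfl⟩
      refine ⟨⟨t, Ioo_subset_Icc_self ht, rfl⟩, ?_⟩
      rintro (h | h)
      · exact ht.1.ne' (hinj (Ioo_subset_Icc_self ht) h0 h)
      · exact ht.2.ne (hinj (Ioo_subset_Icc_self ht) h1 h)
  rw [this]
  exact isPreconnected_Ioo.image f hf.continuousOn

/-- Two arcs that meet only in a common endpoint form an arc. -/
theorem union (hA : IsArc A x z) (hB : IsArc B z y) (hAB : A ∩ B ⊆ {z}) :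
    IsArc (A ∪ B) x y := by
  obtain ⟨f, hf, hfi, rfl, hfz, rfl⟩ := hA.exists_real
  obtain ⟨g, hg, hgi, hgz, rfl, rfl⟩ := hB.exists_real
  let k : ℝ → ℝ × ℝ := fun t => if t ≤ 1 then f t else g (t - 1)
  have hk1 : ∀ t ≤ 1, k t = f t := fun t ht => if_pos ht
  have hk2 : ∀ t, 1 ≤ t → k t = g (t - 1) := fun t ht => by
    rcases ht.eq_or_lt with rfl | ht
    · simp [k, hfz, hgz]
    · exact if_neg ht.not_ge
  have hk : Continuous k := by
    refine Continuous.if_le hf (hg.comp (by fun_prop)) continuous_id continuous_const ?_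
    rintro t rfl
    simp [hfz, hgz]
  have hmeet : ∀ s ∈ Icc (0 : ℝ) 1, ∀ t ∈ Icc (1 : ℝ) 2, k s = k t → s = t := by
    intro s hs t ht hst
    have ht' : t - 1 ∈ Icc (0 : ℝ) 1 := ⟨by linarith [ht.1], by linarith [ht.2]⟩
    rw [hk1 s hs.2, hk2 t ht.1] at hst
    have hz : f s = z := hAB ⟨⟨s, hs, rfl⟩, ⟨t - 1, ht', hst.symm⟩⟩
    have h1 : s = 1 := hfi hs (by simp) (hz.trans hfz.symm)
    have h2 : t - 1 = 0 := hgi ht' (by simp) ((hst.symm.trans hz).trans hgz.symm)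
    linarith
  have hinj : InjOn k (Icc 0 2) := by
    intro s hs t ht hst
    rcases le_total s 1 with hs1 | hs1 <;> rcases le_total t 1 with ht1 | ht1
    · rw [hk1 s hs1, hk1 t ht1] at hst
      exact hfi ⟨hs.1, hs1⟩ ⟨ht.1, ht1⟩ hst
    · exact hmeet s ⟨hs.1, hs1⟩ t ⟨ht1, ht.2⟩ hst
    · exact (hmeet t ⟨ht.1, ht1⟩ s ⟨hs1, hs.2⟩ hst.symm).symm
    · rw [hk2 s hs1, hk2 t ht1] at hst
      have := hgi ⟨by linarith, by linarith [hs.2]⟩ ⟨by linarith, by linarith [ht.2]⟩ hst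
      linarith
  have himg : k '' Icc 0 2 = f '' Icc 0 1 ∪ g '' Icc 0 1 := by
    ext w
    constructor
    · rintro ⟨t, ht, rfl⟩
      rcases le_total t 1 with h | h
      · exact Or.inl ⟨t, ⟨ht.1, h⟩, (hk1 t h).symm⟩
      · exact Or.inr ⟨t - 1, ⟨by linarith, by linarith [ht.2]⟩, (hk2 t h).symm⟩
    · rintro (⟨t, ht, rfl⟩ | ⟨t, ht, rfl⟩)
      · exact ⟨t, ⟨ht.1, by linarith [ht.2]⟩, hk1 t ht.2⟩
      · exact ⟨t + 1, ⟨by linarith [ht.1], by linarith [ht.2]⟩, by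
          rw [hk2 _ (by linarith [ht.1])]; simp⟩
  have := isArc_image_Icc (f := k) (a := 0) (b := 2) two_pos hk.continuousOn hinj
  rw [himg, hk1 0 zero_le_one, hk2 2 one_le_two] at this
  convert this using 2
  norm_num

/-- The initial part of an arc up to its first point in a closed set. -/
theorem exists_initial (hA : IsArc A x y) {C : Set (ℝ × ℝ)} (hC : IsClosed C) (hx : x ∉ C)
    (hne : (A ∩ C).Nonempty) :
    ∃ z B, B ⊆ A ∧ IsArc B x z ∧ z ∈ C ∧ B ∩ C ⊆ {z} ∧ z ∉ interior C ∧ (y ∈ B → y = z) := by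
  obtain ⟨f, hf, hinj, rfl, rfl, rfl⟩ := hA.exists_real
  have hT : IsCompact (Icc (0 : ℝ) 1 ∩ f ⁻¹' C) := isCompact_Icc.inter_right (hC.preimage hf)
  have hTne : (Icc (0 : ℝ) 1 ∩ f ⁻¹' C).Nonempty := by
    obtain ⟨_, ⟨t, ht, rfl⟩, htC⟩ := hne
    exact ⟨t, ht, htC⟩
  obtain ⟨τ, ⟨hτ, hτC⟩, hmin⟩ := hT.exists_isLeast hTne
  have hτ0 : 0 < τ := lt_of_le_of_ne hτ.1 fun h => hx (by rw [h]; exact hτC)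
  have hsub : Icc 0 τ ⊆ Icc (0 : ℝ) 1 := Icc_subset_Icc_right hτ.2
  refine ⟨f τ, f '' Icc 0 τ, image_mono hsub,
    isArc_image_Icc hτ0 hf.continuousOn (hinj.mono hsub), hτC, ?_, ?_, ?_⟩
  · rintro _ ⟨⟨t, ht, rfl⟩, htC⟩
    rw [le_antisymm ht.2 (hmin ⟨hsub ht, htC⟩)]
    rfl
  · intro hint
    have hev : ∀ᶠ t in nhdsWithin τ (Iio τ), f t ∈ C ∧ 0 < t :=
      nhdsWithin_le_nhds <| ((hf.tendsto τ).eventually (mem_interior_iff_mem_nhds.1 hint)).and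
        (lt_mem_nhds hτ0)
    obtain ⟨t, ⟨htC, ht0⟩, htτ⟩ := (hev.and self_mem_nhdsWithin).exists
    exact absurd (hmin ⟨⟨ht0.le, htτ.le.trans hτ.2⟩, htC⟩) (not_le.2 htτ)
  · rintro ⟨t, ht, h1⟩
    have : t = 1 := hinj (hsub ht) (by simp) h1
    rw [← h1, le_antisymm ht.2 (this ▸ hτ.2)]

end IsArc

theorem isArc_segment {x y : ℝ × ℝ} (h : x ≠ y) : IsArc (segment ℝ x y) x y := by
  have := isArc_image_Icc (f := AffineMap.lineMap (k := ℝ) x y) zero_lt_one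
    AffineMap.lineMap_continuous.continuousOn (AffineMap.lineMap_injective ℝ h).injOn
  rwa [AffineMap.lineMap_apply_zero, AffineMap.lineMap_apply_one, ← segment_eq_image_lineMap] at this

/-- Inside a ball, the plane can be deformed so that the centre moves to any given point. -/
theorem exists_homeomorph_of_mem_ball {z z' : ℝ × ℝ} {δ : ℝ} (hz : z' ∈ ball z δ) :
    ∃ h : (ℝ × ℝ) ≃ₜ (ℝ × ℝ), (∀ x ∉ ball z δ, h x = x) ∧ h z = z' := by
  have hδ : 0 < δ := dist_nonneg.trans_lt hz
  have hv : ‖z' - z‖ < δ := by rwa [mem_ball_iff_norm] at hz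
  let φ : ℝ × ℝ → ℝ := fun x => max 0 (1 - ‖x - z‖ / δ)
  let f : ℝ × ℝ → ℝ × ℝ := fun x => x + φ x • (z' - z)
  let c : NNReal := ⟨‖z' - z‖ / δ, by positivity⟩
  have hφ : ∀ x y, |φ x - φ y| ≤ ‖x - y‖ / δ := by
    intro x y
    have h1 : |φ x - φ y| ≤ |(1 - ‖x - z‖ / δ) - (1 - ‖y - z‖ / δ)| :=
      abs_max_sub_max_le_max 0 _ 0 _ |>.trans (by simp)
    have h2 : (1 - ‖x - z‖ / δ) - (1 - ‖y - z‖ / δ) = (‖y - z‖ - ‖x - z‖) / δ := by ring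
    rw [h2, abs_div, abs_of_pos hδ] at h1
    refine h1.trans ?_
    gcongr
    have h3 := abs_norm_sub_norm_le (y - z) (x - z)
    rwa [sub_sub_sub_cancel_right, norm_sub_rev y x] at h3
  have happ : ApproximatesLinearOn f
      ((ContinuousLinearEquiv.refl ℝ (ℝ × ℝ) : (ℝ × ℝ) ≃L[ℝ] (ℝ × ℝ)) : (ℝ × ℝ) →L[ℝ] (ℝ × ℝ))
      univ c := by
    intro x _ y _
    have : f x - f y - (x - y) = (φ x - φ y) • (z' - z) := by
      simp only [f, sub_smul]; abel
    simp only [ContinuousLinearEquiv.coe_refl, ContinuousLinearMap.coe_id', id_eq]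
    rw [this, norm_smul, Real.norm_eq_abs]
    calc |φ x - φ y| * ‖z' - z‖ ≤ ‖x - y‖ / δ * ‖z' - z‖ := by gcongr; exact hφ x y
      _ = ‖z' - z‖ / δ * ‖x - y‖ := by ring
  refine ⟨happ.toHomeomorph f (Or.inr ?_), ?_, ?_⟩
  · have : c < 1 := by
      rw [← NNReal.coe_lt_coe]
      exact (div_lt_one hδ).2 hv
    refine this.trans_le ?_
    simp
  · intro x hx
    have hx' : δ ≤ ‖x - z‖ := by rw [mem_ball_iff_norm] at hx; exact not_lt.1 hx
    have h0 : φ x = 0 := max_eq_left (by rw [sub_nonpos]; exact (one_le_div hδ).2 hx')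
    change f x = x
    simp [f, h0]
  · change f z = z'
    simp [f, φ]

/-- Two points of a connected part of an open set are exchanged by a homeomorphism of the plane
that is the identity outside of the open set. -/
theorem exists_homeomorph_of_isPreconnected {U T : Set (ℝ × ℝ)} (hU : IsOpen U) (hTU : T ⊆ U)
    (hT : IsPreconnected T) {x y : ℝ × ℝ} (hx : x ∈ T) (hy : y ∈ T) :
    ∃ h : (ℝ × ℝ) ≃ₜ (ℝ × ℝ), (∀ u ∉ U, h u = u) ∧ h x = y := by
  refine hT.induction₂ (fun x y => ∃ h : (ℝ × ℝ) ≃ₜ (ℝ × ℝ), (∀ u ∉ U, h u = u) ∧ h x = y)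
    ?_ ?_ ?_ hx hy
  · intro x hx
    obtain ⟨δ, hδ, hball⟩ := Metric.isOpen_iff.1 hU x (hTU hx)
    filter_upwards [mem_nhdsWithin_of_mem_nhds (ball_mem_nhds x hδ)] with y hy
    obtain ⟨h, hfix, hxy⟩ := exists_homeomorph_of_mem_ball hy
    exact ⟨h, fun u hu => hfix u fun hu' => hu (hball hu'), hxy⟩
  · rintro x y z - - - ⟨h, hfix, rfl⟩ ⟨k, kfix, rfl⟩
    exact ⟨h.trans k, fun u hu => by simp [hfix u hu, kfix u hu], rfl⟩
  · rintro x y - - ⟨h, hfix, rfl⟩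
    exact ⟨h.symm, fun u hu => by rw [h.symm_apply_eq, hfix u hu], by simp⟩

theorem eq_of_mem_segment_of_dist_eq {c x z : ℝ × ℝ} {r : ℝ} (hr : 0 < r) (hx : dist x c = r)
    (hz : dist z c = r) (hzx : z ∈ segment ℝ c x) : z = x := by
  rw [segment_eq_image_lineMap] at hzx
  obtain ⟨t, ht, rfl⟩ := hzx
  rw [dist_lineMap_left, dist_comm c x, hx, Real.norm_of_nonneg ht.1] at hz
  have : t = 1 := by nlinarith
  simp [this]

theorem segment_inter_segment_subset {c x x' : ℝ × ℝ} {r : ℝ} (hr : 0 < r) (hx : dist x c = r)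
    (hx' : dist x' c = r) (hne : x ≠ x') : segment ℝ c x ∩ segment ℝ c x' ⊆ {c} := by
  rintro z ⟨hz, hz'⟩
  rw [segment_eq_image_lineMap] at hz hz'
  obtain ⟨t, ht, rfl⟩ := hz
  obtain ⟨s, hs, hst⟩ := hz'
  have h := congrArg (dist · c) hst
  simp only [dist_lineMap_left, dist_comm c, hx, hx', Real.norm_of_nonneg ht.1,
    Real.norm_of_nonneg hs.1] at h
  have hts : s = t := mul_right_cancel₀ hr.ne' h
  subst hts
  rcases eq_or_ne s 0 with rfl | hs0
  · simp
  · rw [AffineMap.lineMap_apply, AffineMap.lineMap_apply, vadd_eq_add, vadd_eq_add,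
      add_left_inj, vsub_eq_sub, vsub_eq_sub] at hst
    exact absurd (sub_left_injective (smul_right_injective _ hs0 hst)).symm hne

set_option maxHeartbeats 1000000 in
/-- A closed region at `c` around the radius towards `u` that is strictly star-shaped around `c`
and avoids finitely many other radii. -/
theorem exists_lens {c u : ℝ × ℝ} {r : ℝ} (hr : 0 < r) (hu : dist u c = r) {X : Set (ℝ × ℝ)}
    (hX : X.Finite) (hXr : ∀ x ∈ X, dist x c = r) (huX : u ∉ X) :
    ∃ Q : Set (ℝ × ℝ), IsClosed Q ∧ c ∈ Q ∧ Q ⊆ closedBall c r ∧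
      (∃ y ∈ interior Q, y ∈ openSegment ℝ c u) ∧
      (∀ x ∈ X, segment ℝ c x ∩ Q ⊆ {c}) ∧
      (∀ x ∈ Q, x ≠ c → openSegment ℝ c x ⊆ interior Q) := by
  obtain ⟨c₁, c₂⟩ := c
  obtain ⟨v, rfl⟩ : ∃ v, u = (c₁, c₂) + v := ⟨u - (c₁, c₂), by simp⟩
  obtain ⟨v₁, v₂⟩ := v
  have hvr : max |v₁| |v₂| = r := by
    rw [← hu, dist_eq_norm, add_sub_cancel_left, Prod.norm_def]
    rfl
  set n : ℝ := v₁ ^ 2 + v₂ ^ 2 with hn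
  have hv1 : |v₁| ≤ r := hvr ▸ le_max_left _ _
  have hv2 : |v₂| ≤ r := hvr ▸ le_max_right _ _
  have hn0 : 0 < n := by
    rcases max_choice |v₁| |v₂| with h | h
    · have : |v₁| ^ 2 = r ^ 2 := by rw [← h, hvr]
      rw [sq_abs] at this
      nlinarith [sq_nonneg v₂, pow_pos hr 2]
    · have : |v₂| ^ 2 = r ^ 2 := by rw [← h, hvr]
      rw [sq_abs] at this
      nlinarith [sq_nonneg v₁, pow_pos hr 2]
  have hn2 : n ≤ 2 * r ^ 2 := by
    have h1 := sq_le_sq' (by linarith [neg_abs_le v₁]) ((le_abs_self v₁).trans hv1)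
    have h2 := sq_le_sq' (by linarith [neg_abs_le v₂]) ((le_abs_self v₂).trans hv2)
    linarith
  let s : ℝ × ℝ → ℝ := fun z => v₁ * (z.1 - c₁) + v₂ * (z.2 - c₂)
  let t : ℝ × ℝ → ℝ := fun z => v₁ * (z.2 - c₂) - v₂ * (z.1 - c₁)
  have hst : ∀ z, (s z) ^ 2 + (t z) ^ 2 = n * ((z.1 - c₁) ^ 2 + (z.2 - c₂) ^ 2) := fun z => by
    simp only [s, t, hn]; ring
  obtain ⟨ε, hε0, hεn, hεX⟩ : ∃ ε : ℝ, 0 < ε ∧ ε * n ≤ 1 ∧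
      ∀ x ∈ X, t x ≠ 0 → ε * (|s x| * n) < |t x| := by
    have hev : ∀ᶠ ε : ℝ in nhds 0, ε * n < 1 ∧ ∀ x ∈ X, t x ≠ 0 → ε * (|s x| * n) < |t x| := by
      refine Filter.Eventually.and ?_ ((Filter.eventually_all_finite hX).2 fun x _ => ?_)
      · exact (continuous_id.mul continuous_const).continuousAt.eventually_lt continuousAt_const
          (by simp)
      · by_cases hx : t x = 0
        · simp [hx]
        · filter_upwards [(continuous_id.mul continuous_const).continuousAt.eventually_lt
            (f := fun ε : ℝ => ε * (|s x| * n)) (g := fun _ => |t x|) continuousAt_const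
            (by simpa using hx)] with ε h _ using h
    obtain ⟨ε, ⟨h1, h2⟩, h0⟩ :=
      ((hev.filter_mono nhdsWithin_le_nhds).and (self_mem_nhdsWithin (s := Ioi (0 : ℝ)))).exists
    exact ⟨ε, h0, h1.le, h2⟩
  let F : ℝ × ℝ → ℝ := fun z => ε * (s z * (n / 2 - s z)) - |t z|
  have hF : Continuous F := by fun_prop
  have hint : ∀ z, 0 < F z → z ∈ interior {z | 0 ≤ F z} := fun z hz =>
    mem_interior.2 ⟨{z | 0 < F z}, fun z hz => le_of_lt (α := ℝ) hz, isOpen_lt continuous_const hF, hz⟩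
  have hs_line : ∀ (x : ℝ × ℝ) (l : ℝ), s (AffineMap.lineMap (c₁, c₂) x l) = l * s x := by
    intro x l; simp [s, AffineMap.lineMap_apply]; ring
  have ht_line : ∀ (x : ℝ × ℝ) (l : ℝ), t (AffineMap.lineMap (c₁, c₂) x l) = l * t x := by
    intro x l; simp [t, AffineMap.lineMap_apply]; ring
  have hQ : ∀ z, 0 ≤ F z → 0 ≤ s z ∧ s z ≤ n / 2 := by
    intro z hz
    have h1 : 0 ≤ s z * (n / 2 - s z) := by
      have : 0 ≤ ε * (s z * (n / 2 - s z)) := by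
        have := abs_nonneg (t z)
        simp only [F] at hz
        linarith
      exact nonneg_of_mul_nonneg_right this hε0
    constructor <;> by_contra! h <;> nlinarith
  have hzero : ∀ z, s z = 0 → t z = 0 → z = (c₁, c₂) := by
    intro z h1 h2
    have h3 := hst z
    rw [h1, h2] at h3
    have h4 : (z.1 - c₁) ^ 2 + (z.2 - c₂) ^ 2 = 0 := by
      rcases mul_eq_zero.1 (h3.symm.trans (by ring)) with h | h
      · exact absurd h hn0.ne'
      · exact h
    have h5 : z.1 - c₁ = 0 := by nlinarith [sq_nonneg (z.1 - c₁), sq_nonneg (z.2 - c₂)]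
    have h6 : z.2 - c₂ = 0 := by nlinarith [sq_nonneg (z.1 - c₁), sq_nonneg (z.2 - c₂)]
    exact Prod.ext (by simpa using sub_eq_zero.1 h5) (by simpa using sub_eq_zero.1 h6)
  refine ⟨{z | 0 ≤ F z}, isClosed_le continuous_const hF, by simp [F, s, t], ?_, ?_, ?_, ?_⟩
  · intro z hz
    obtain ⟨hs0, hs1⟩ := hQ z hz
    have ht : |t z| ≤ n / 4 := by
      have h1 : |t z| ≤ ε * (s z * (n / 2 - s z)) := by
        simp only [mem_ofPred_eq, F] at hz
        linarith
      have h2 : s z * (n / 2 - s z) ≤ n * (n / 4) := by nlinarith [sq_nonneg (s z - n / 4)]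
      have h3 : ε * (s z * (n / 2 - s z)) ≤ ε * (n * (n / 4)) := by gcongr
      nlinarith
    have ht2 : (t z) ^ 2 ≤ (n / 4) ^ 2 := sq_le_sq.2 (by rwa [abs_of_pos (by linarith : 0 < n / 4)])
    have hs2 : (s z) ^ 2 ≤ (n / 2) ^ 2 := by gcongr
    have hsum : (z.1 - c₁) ^ 2 + (z.2 - c₂) ^ 2 ≤ r ^ 2 := by
      have h1 := hst z
      have h2 : n * ((z.1 - c₁) ^ 2 + (z.2 - c₂) ^ 2) ≤ n * (r ^ 2) := by nlinarith
      exact le_of_mul_le_mul_left h2 hn0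
    rw [mem_closedBall, Prod.dist_eq, Real.dist_eq, Real.dist_eq]
    refine max_le ?_ ?_ <;> refine abs_le_of_sq_le_sq ?_ hr.le <;>
      nlinarith [sq_nonneg (z.1 - c₁), sq_nonneg (z.2 - c₂)]
  · refine ⟨AffineMap.lineMap (c₁, c₂) ((c₁, c₂) + (v₁, v₂)) (1 / 4 : ℝ), hint _ ?_, ?_⟩
    · have h1 : s ((c₁, c₂) + (v₁, v₂)) = n := by simp [s, hn]; ring
      have h2 : t ((c₁, c₂) + (v₁, v₂)) = 0 := by simp [t]; ring
      simp only [F, hs_line, ht_line, h1, h2]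
      have : 0 < ε * (1 / 4 * n * (n / 2 - 1 / 4 * n)) := by
        have : 0 < 1 / 4 * n * (n / 2 - 1 / 4 * n) := by nlinarith
        positivity
      simpa using this
    · rw [openSegment_eq_image_lineMap]
      exact ⟨1 / 4, by norm_num, rfl⟩
  · rintro x hx z ⟨hz, hzQ⟩
    rw [segment_eq_image_lineMap] at hz
    obtain ⟨l, hl, rfl⟩ := hz
    rcases hl.1.eq_or_lt with rfl | hl0
    · simp
    exfalso
    have hxc : x ≠ (c₁, c₂) := by
      rintro rfl
      have := hXr _ hx
      rw [dist_self] at this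
      exact hr.ne this
    have hs := (hQ _ hzQ).1
    rw [hs_line] at hs
    have hs0 : 0 ≤ s x := nonneg_of_mul_nonneg_right hs hl0
    by_cases ht : t x = 0
    · have hspos : 0 < s x := lt_of_le_of_ne hs0 fun h => hxc (hzero x h.symm ht)
      apply huX
      have e1 : n * (x.1 - c₁) = s x * v₁ := by
        have : n * (x.1 - c₁) = s x * v₁ - t x * v₂ := by simp only [s, t, hn]; ring
        rw [this, ht]; ring
      have e2 : n * (x.2 - c₂) = s x * v₂ := by
        have : n * (x.2 - c₂) = s x * v₂ + t x * v₁ := by simp only [s, t, hn]; ring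
        rw [this, ht]; ring
      have hmax : max |x.1 - c₁| |x.2 - c₂| = r := by
        rw [← hXr x hx, Prod.dist_eq, Real.dist_eq, Real.dist_eq]
      have hscale : n * r = s x * r := by
        conv_lhs => rw [← hmax, ← abs_of_pos hn0]
        conv_rhs => rw [← hvr, ← abs_of_pos hspos]
        rw [mul_max_of_nonneg _ _ (abs_nonneg _), mul_max_of_nonneg _ _ (abs_nonneg _),
          ← abs_mul, ← abs_mul, ← abs_mul, ← abs_mul, e1, e2]
      have hsn : s x = n := (mul_right_cancel₀ hr.ne' hscale).symm
      rw [hsn] at e1 e2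
      have f1 := mul_left_cancel₀ hn0.ne' e1
      have f2 := mul_left_cancel₀ hn0.ne' e2
      have : x = (c₁, c₂) + (v₁, v₂) := Prod.ext (by simp; linarith) (by simp; linarith)
      rwa [← this]
    · have h1 := hεX x hx ht
      simp only [mem_ofPred_eq, F, hs_line, ht_line, abs_mul, abs_of_pos hl0] at hzQ
      rw [abs_of_nonneg hs0] at h1
      have h2 : ε * (l * s x * (n / 2 - l * s x)) ≤ l * (ε * (s x * n)) := by
        have : l * s x * (n / 2 - l * s x) ≤ l * (s x * n) := by nlinarith [mul_nonneg hs hn0.le]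
        calc _ ≤ ε * (l * (s x * n)) := by gcongr
          _ = _ := by ring
      nlinarith
  · intro x hx hxc z hz
    rw [openSegment_eq_image_lineMap] at hz
    obtain ⟨l, hl, rfl⟩ := hz
    refine hint _ ?_
    obtain ⟨hs0, hs1⟩ := hQ x hx
    have hspos : 0 < s x := lt_of_le_of_ne hs0 fun h => by
      refine hxc (hzero x h.symm ?_)
      simp only [mem_ofPred_eq, F, ← h] at hx
      simpa using hx
    simp only [mem_ofPred_eq, F] at hx
    simp only [F, hs_line, ht_line, abs_mul, abs_of_pos hl.1]
    have h1 : 0 < ε * (l * (1 - l) * (s x) ^ 2) := by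
      have := sub_pos.2 hl.2
      have := hl.1
      positivity
    nlinarith [mul_nonneg hl.1.le hx]

theorem mem_segment_or_of_mem_segment {c x z u : ℝ × ℝ} (huc : u ≠ c) (hx : u ∈ segment ℝ c x)
    (hz : u ∈ segment ℝ c z) : z ∈ segment ℝ c x ∨ x ∈ segment ℝ c z := by
  have key : ∀ {v w : ℝ × ℝ} {s t : ℝ}, 0 ≤ s → s ≤ t → 0 < t →
      c + s • (v - c) = c + t • (w - c) → w ∈ segment ℝ c v := by
    intro v w s t hs hst ht h
    rw [segment_eq_image']
    refine ⟨s / t, ⟨div_nonneg hs ht.le, (div_le_one ht).2 hst⟩, ?_⟩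
    have h' : s • (v - c) = t • (w - c) := add_left_cancel h
    change c + (s / t) • (v - c) = w
    rw [div_eq_inv_mul, mul_smul, h', inv_smul_smul₀ ht.ne']
    abel
  rw [segment_eq_image'] at hx hz
  obtain ⟨s, hs, rfl⟩ := hx
  obtain ⟨t, ht, hst⟩ := hz
  have hs0 : s ≠ 0 := fun h => huc (by simp [h])
  have ht0 : t ≠ 0 := fun h => huc (by rw [← hst]; simp [h])
  rcases le_total s t with h | h
  · exact Or.inl (key hs.1 h (lt_of_le_of_ne ht.1 ht0.symm) hst.symm)
  · exact Or.inr (key ht.1 h (lt_of_le_of_ne hs.1 hs0.symm) hst)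

/-- Given arcs from `a` and from `d` to a common point `p`, both avoiding a closed set `R`, and a
lens at `c ∈ R` that can be reached from `p` outside of `R`, the points `a` and `d` can be joined
to `c` by arcs outside of `R` that meet only at `c`. -/
theorem exists_rerouting {R A B T Q : Set (ℝ × ℝ)} {a c d p y : ℝ × ℝ} (hR : IsClosed R)
    (ha : a ∈ R) (hc : c ∈ R) (hd : d ∈ R) (hac : a ≠ c) (hdc : d ≠ c)
    (hA : IsArc A a p) (hB : IsArc B d p) (hAR : A ∩ R ⊆ {a}) (hBR : B ∩ R ⊆ {d})
    (hAB : A ∩ B ⊆ {p}) (hT : IsPreconnected T) (hTR : T ⊆ Rᶜ) (hp : p ∈ T) (hy : y ∈ T)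
    (hQ : IsClosed Q) (hcQ : c ∈ Q) (hQR : Q ∩ R ⊆ {c}) (hyQ : y ∈ interior Q)
    (hstar : ∀ x ∈ Q, x ≠ c → openSegment ℝ c x ⊆ interior Q) :
    ∃ x A' B', IsArc A' a x ∧ x ≠ c ∧ IsArc B' d c ∧ x ∉ R ∧ A' ∩ R ⊆ {a} ∧
      segment ℝ c x ∩ R ⊆ {c} ∧ B' ∩ R ⊆ {c, d} ∧ A' ∩ segment ℝ c x ⊆ {x} ∧
      Disjoint A' B' ∧ segment ℝ c x ∩ B' ⊆ {c} := by
  obtain ⟨h, hfix, rfl⟩ := exists_homeomorph_of_isPreconnected hR.isOpen_compl hTR hT hp hy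
  replace hfix : ∀ u ∈ R, h u = u := fun u hu => hfix u (not_not.2 hu)
  have hmove : ∀ {E : Set (ℝ × ℝ)} {e : ℝ × ℝ}, E ∩ R ⊆ {e} → h '' E ∩ R ⊆ {e} := by
    rintro E e hE _ ⟨⟨u, hu, rfl⟩, huR⟩
    have : h u = u := h.injective (hfix _ huR)
    rw [this] at huR ⊢
    exact hE ⟨hu, huR⟩
  have hinit : ∀ {E : Set (ℝ × ℝ)} {e : ℝ × ℝ}, e ∈ R → e ≠ c → IsArc E e p → E ∩ R ⊆ {e} →
      ∃ z E', E' ⊆ h '' E ∧ IsArc E' e z ∧ z ∈ Q ∧ E' ∩ Q ⊆ {z} ∧ z ∉ interior Q ∧ E' ∩ R ⊆ {e} ∧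
        z ∉ R := by
    intro E e heR hec hE hER
    have hE' := hE.image h
    rw [hfix e heR] at hE'
    have heQ : e ∉ Q := fun heQ => hec (hQR ⟨heQ, heR⟩)
    obtain ⟨z, E', hsub, harc, hzQ, hmeet, hzint, -⟩ :=
      hE'.exists_initial hQ heQ ⟨h p, hE'.right_mem, interior_subset hyQ⟩
    have hE'R : E' ∩ R ⊆ {e} := (inter_subset_inter_left _ hsub).trans (hmove hER)
    refine ⟨z, E', hsub, harc, hzQ, hmeet, hzint, hE'R, fun hzR => heQ ?_⟩
    rw [← show z = e from hE'R ⟨harc.right_mem, hzR⟩]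
    exact hzQ
  obtain ⟨x, A', hA', hA'x, hxQ, hA'Q, hxint, hA'R, hxR⟩ := hinit ha hac hA hAR
  obtain ⟨z, B', hB', hB'z, hzQ, hB'Q, hzint, hB'R, hzR⟩ := hinit hd hdc hB hBR
  have hxc : x ≠ c := fun e => hxR (e ▸ hc)
  have hzc : z ≠ c := fun e => hzR (e ▸ hc)
  have hdisj : ∀ q ∈ A', q ∉ B' := by
    intro q hqA hqB
    obtain ⟨u, hu, rfl⟩ := hA' hqA
    obtain ⟨u', hu', huu⟩ := hB' hqB
    rw [h.injective huu] at hu'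
    have : u = p := hAB ⟨hu, hu'⟩
    subst this
    exact hxint ((hA'Q ⟨hqA, interior_subset hyQ⟩ : h u = x) ▸ hyQ)
  have hxz : x ≠ z := fun e => hdisj x hA'x.right_mem (e ▸ hB'z.right_mem)
  have hray : ∀ {u v}, v ∈ Q → v ≠ c → u ≠ c → u ≠ v → u ∉ interior Q → u ∉ segment ℝ c v := by
    intro u v hv hvc huc huv hu hmem
    exact hu (hstar v hv hvc (mem_openSegment_of_ne_left_right huc.symm huv.symm hmem))
  have hseg : ∀ {v}, v ∈ Q → v ≠ c → segment ℝ c v ⊆ Q := by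
    intro v hv hvc u hu
    by_cases huc : u = c
    · exact huc ▸ hcQ
    by_cases huv : u = v
    · exact huv ▸ hv
    · exact interior_subset (hstar v hv hvc
        (mem_openSegment_of_ne_left_right (Ne.symm huc) (Ne.symm huv) hu))
  have hzx : segment ℝ c x ∩ segment ℝ c z ⊆ {c} := by
    rintro u ⟨hu, hu'⟩
    by_contra huc
    rcases mem_segment_or_of_mem_segment huc hu hu' with h | h
    · exact hray hxQ hxc hzc hxz.symm hzint h
    · exact hray hzQ hzc hxc hxz hxint h
  have hxB : segment ℝ c x ∩ B' ⊆ ∅ := by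
    rintro u ⟨hu, huB⟩
    have : u = z := hB'Q ⟨huB, hseg hxQ hxc hu⟩
    subst this
    exact hray hxQ hxc hzc hxz.symm hzint hu
  refine ⟨x, A', B' ∪ segment ℝ z c, hA'x, hxc, hB'z.union (isArc_segment hzc) ?_, hxR, hA'R, ?_,
    ?_, ?_, ?_, ?_⟩
  · rintro u ⟨hu, hu'⟩
    rw [segment_symm] at hu'
    exact hB'Q ⟨hu, hseg hzQ hzc hu'⟩
  · rintro u ⟨hu, huR⟩
    exact hQR ⟨hseg hxQ hxc hu, huR⟩
  · rintro u ⟨hu | hu, huR⟩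
    · exact Or.inr (hB'R ⟨hu, huR⟩)
    · rw [segment_symm] at hu
      exact Or.inl (hQR ⟨hseg hzQ hzc hu, huR⟩)
  · rintro u ⟨hu, hu'⟩
    exact hA'Q ⟨hu, hseg hxQ hxc hu'⟩
  · rw [disjoint_left]
    rintro u hu (hu' | hu')
    · exact hdisj u hu hu'
    · rw [segment_symm] at hu'
      have : u = x := hA'Q ⟨hu, hseg hzQ hzc hu'⟩
      subst this
      exact hray hzQ hzc hxc hxz hxint hu'
  · rintro u ⟨hu, hu' | hu'⟩
    · exact (hxB ⟨hu, hu'⟩).elim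
    · rw [segment_symm] at hu'
      exact hzx ⟨hu, hu'⟩

section

variable {V : Type*} {G : SimpleGraph V}

theorem Drawing.isCompact_arc (D : Drawing G) {e : Sym2 V} (he : e ∈ G.edgeSet) :
    IsCompact (D.arc e) := by
  induction e with | _ u v => exact (D.arc_curve _ he u v rfl).isCompact

theorem Drawing.Crosses.symm {D : Drawing G} {e e' : Sym2 V} {p : ℝ × ℝ} (h : D.Crosses e e' p) :
    D.Crosses e' e p :=
  ⟨h.2.1, h.1, h.2.2.1.symm, h.2.2.2.2.1, h.2.2.2.1, h.2.2.2.2.2⟩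

theorem Drawing.IsSRestricted.of_crosses_subset {D D' : Drawing G} {S : Set CrossingType}
    (h : D.IsSRestricted S) (hsub : ∀ e e' p, D'.Crosses e e' p → D.Crosses e e' p) :
    D'.IsSRestricted S :=
  ⟨⟨fun e e₁ e₂ p q h₁ h₂ => h.1.1 e e₁ e₂ p q (hsub _ _ _ h₁) (hsub _ _ _ h₂),
    fun e e' p h' => h.1.2 e e' p (hsub _ _ _ h')⟩,
    fun a b c d p hp => h.2 a b c d p (hsub _ _ _ hp)⟩

/-- The edges at `c` enter a small disc around `c` along radii towards the points `ξ e`. -/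
structure Drawing.IsRadialAt (D : Drawing G) (c : V) (r : ℝ) (ξ : Sym2 V → ℝ × ℝ) : Prop where
  pos_notMem : ∀ v, v ≠ c → D.pos v ∉ closedBall (D.pos c) r
  disjoint : ∀ e ∈ G.edgeSet, c ∉ e → Disjoint (D.arc e) (closedBall (D.pos c) r)
  dist_eq : ∀ e ∈ G.edgeSet, c ∈ e → dist (ξ e) (D.pos c) = r
  arc_inter : ∀ e ∈ G.edgeSet, c ∈ e →
    D.arc e ∩ closedBall (D.pos c) r = segment ℝ (D.pos c) (ξ e)
  ne : ∀ e ∈ G.edgeSet, c ∈ e → ∀ e' ∈ G.edgeSet, c ∈ e' → e ≠ e' → ξ e ≠ ξ e'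

theorem Drawing.exists_isRadialAt [Finite V] (D : Drawing G) (c : V) :
    ∃ (D' : Drawing G) (r : ℝ) (ξ : Sym2 V → ℝ × ℝ), 0 < r ∧ D'.IsRadialAt c r ξ ∧
      ∀ e e' p, D'.Crosses e e' p → D.Crosses e e' p := by
  classical
  let N : Set (ℝ × ℝ) := (⋃ e ∈ {e ∈ G.edgeSet | c ∉ e}, D.arc e) ∪ D.pos '' {v | v ≠ c} ∪
    ⋃ e ∈ G.edgeSet, ⋃ e' ∈ {e' ∈ G.edgeSet | e ≠ e'}, (D.arc e ∩ D.arc e') \ {D.pos c}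
  have hN : IsClosed N := by
    refine IsClosed.union (IsClosed.union ?_ (toFinite _).isClosed) ?_
    · exact (toFinite _).isClosed_biUnion fun e he => (D.isCompact_arc he.1).isClosed
    · refine (toFinite _).isClosed_biUnion fun e he => (toFinite _).isClosed_biUnion fun e' he' => ?_
      exact ((D.arc_finite_inter e he e' he'.1 he'.2).subset sdiff_subset).isClosed
  have hcN : D.pos c ∉ N := by
    rintro ((h | ⟨v, hv, hvc⟩) | h)
    · simp only [mem_iUnion] at h
      obtain ⟨e, he, hce⟩ := h
      exact he.2 (D.arc_avoid e he.1 c hce)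
    · exact hv (D.pos_inj hvc)
    · simp only [mem_iUnion] at h
      obtain ⟨e, he, e', he', hce⟩ := h
      exact hce.2 rfl
  obtain ⟨r, hr, hball⟩ := Metric.nhds_basis_closedBall.mem_iff.1 (hN.isOpen_compl.mem_nhds hcN)
  set C := closedBall (D.pos c) r with hC
  have hposC : ∀ v, v ≠ c → D.pos v ∉ C := fun v hv h => hball h (Or.inl (Or.inr ⟨v, hv, rfl⟩))
  have harcC : ∀ e ∈ G.edgeSet, c ∉ e → ∀ q ∈ D.arc e, q ∉ C := fun e he hce q hq h =>
    hball h (Or.inl (Or.inl (mem_biUnion (show e ∈ {e ∈ G.edgeSet | c ∉ e} from ⟨he, hce⟩) hq)))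
  have hcrossC : ∀ e ∈ G.edgeSet, ∀ e' ∈ G.edgeSet, e ≠ e' → ∀ q ∈ D.arc e, q ∈ D.arc e' → q ∈ C →
      q = D.pos c := by
    intro e he e' he' hne q hq hq' hqC
    by_contra hqc
    refine hball hqC (Or.inr (mem_biUnion he (mem_biUnion
      (show e' ∈ {e' ∈ G.edgeSet | e ≠ e'} from ⟨he', hne⟩) ⟨⟨hq, hq'⟩, hqc⟩)))
  have hex : ∀ e : Sym2 V, ∃ (x : ℝ × ℝ) (A : Set (ℝ × ℝ)), e ∈ G.edgeSet → c ∈ e →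
      dist x (D.pos c) = r ∧ A ⊆ D.arc e ∧ A ∩ C ⊆ {x} ∧ x ∈ A ∧
        ∀ v, e = s(v, c) → IsArc A (D.pos v) x := by
    intro e
    by_cases h : e ∈ G.edgeSet ∧ c ∈ e
    · obtain ⟨he, hce⟩ := h
      obtain ⟨v, rfl⟩ := Sym2.mem_iff_exists.1 hce
      have hvc : v ≠ c := (G.ne_of_adj he).symm
      obtain ⟨x, A, hA, hAx, hxC, hAC, hxint, -⟩ := (D.arc_curve _ he v c Sym2.eq_swap).exists_initial
        (C := C) isClosed_closedBall (hposC v hvc)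
        ⟨D.pos c, (D.arc_curve _ he c v rfl).left_mem, mem_closedBall_self hr.le⟩
      refine ⟨x, A, fun _ _ => ⟨?_, hA, hAC, hAx.right_mem, fun u hu => ?_⟩⟩
      · refine le_antisymm hxC (not_lt.1 fun hlt => hxint ?_)
        exact ball_subset_interior_closedBall hlt
      · rw [Sym2.eq_swap, Sym2.congr_left] at hu
        exact hu ▸ hAx
    · exact ⟨0, ∅, fun h1 h2 => absurd ⟨h1, h2⟩ h⟩
  choose ξ A hξA using hex
  have hξne : ∀ e ∈ G.edgeSet, c ∈ e → ∀ e' ∈ G.edgeSet, c ∈ e' → e ≠ e' → ξ e ≠ ξ e' := by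
    intro e he hce e' he' hce' hne heq
    obtain ⟨h1, h2, -, h4, -⟩ := hξA e he hce
    obtain ⟨-, h2', -, h4', -⟩ := hξA e' he' hce'
    have := hcrossC e he e' he' hne (ξ e) (h2 h4) (heq ▸ h2' h4') h1.le
    rw [this, dist_self] at h1
    exact hr.ne h1
  have hsegC : ∀ e ∈ G.edgeSet, c ∈ e → segment ℝ (D.pos c) (ξ e) ⊆ C := fun e he hce =>
    (convex_closedBall _ _).segment_subset (mem_closedBall_self hr.le) (hξA e he hce).1.le
  let arc' : Sym2 V → Set (ℝ × ℝ) := fun e =>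
    if c ∈ e then A e ∪ segment ℝ (D.pos c) (ξ e) else D.arc e
  have harc1 : ∀ e, c ∈ e → arc' e = A e ∪ segment ℝ (D.pos c) (ξ e) := fun e h => if_pos h
  have harc2 : ∀ e, c ∉ e → arc' e = D.arc e := fun e h => if_neg h
  have hinter1 : ∀ e ∈ G.edgeSet, c ∈ e → ∀ e' ∈ G.edgeSet, c ∉ e' →
      arc' e ∩ arc' e' ⊆ D.arc e ∩ D.arc e' := by
    rintro e he hce e' he' hce' q ⟨hq, hq'⟩
    rw [harc2 e' hce'] at hq'
    rw [harc1 e hce] at hq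
    rcases hq with hq | hq
    · exact ⟨(hξA e he hce).2.1 hq, hq'⟩
    · exact absurd (hsegC e he hce hq) (harcC e' he' hce' q hq')
  have hinter : ∀ e ∈ G.edgeSet, ∀ e' ∈ G.edgeSet, e ≠ e' →
      arc' e ∩ arc' e' ⊆ (D.arc e ∩ D.arc e') ∪ {D.pos c} := by
    intro e he e' he' hne
    by_cases hce : c ∈ e <;> by_cases hce' : c ∈ e'
    · have key : ∀ f ∈ G.edgeSet, c ∈ f → ∀ f' ∈ G.edgeSet, c ∈ f' → f ≠ f' →
          ∀ q ∈ A f, q ∉ segment ℝ (D.pos c) (ξ f') := by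
        intro f hf hcf f' hf' hcf' hff q hq hq'
        obtain ⟨h1, -, h3, -, -⟩ := hξA f hf hcf
        have hqf : q = ξ f := h3 ⟨hq, hsegC f' hf' hcf' hq'⟩
        subst hqf
        exact hξne f hf hcf f' hf' hcf' hff
          (eq_of_mem_segment_of_dist_eq hr (hξA f' hf' hcf').1 h1 hq')
      rintro q ⟨hq, hq'⟩
      rw [harc1 e hce] at hq
      rw [harc1 e' hce'] at hq'
      rcases hq with hq | hq <;> rcases hq' with hq' | hq'
      · exact Or.inl ⟨(hξA e he hce).2.1 hq, (hξA e' he' hce').2.1 hq'⟩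
      · exact absurd hq' (key e he hce e' he' hce' hne q hq)
      · exact absurd hq (key e' he' hce' e he hce hne.symm q hq')
      · exact Or.inr (segment_inter_segment_subset hr (hξA e he hce).1 (hξA e' he' hce').1
          (hξne e he hce e' he' hce' hne) ⟨hq, hq'⟩)
    · exact (hinter1 e he hce e' he' hce').trans subset_union_left
    · rw [inter_comm, inter_comm (D.arc e)]
      exact (hinter1 e' he' hce' e he hce).trans subset_union_left
    · rw [harc2 e hce, harc2 e' hce']
      exact subset_union_left
  have hcurve : ∀ v, s(v, c) ∈ G.edgeSet → IsArc (arc' s(v, c)) (D.pos v) (D.pos c) := by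
    intro v he
    have hce : c ∈ s(v, c) := Sym2.mem_mk_right _ _
    obtain ⟨h1, -, h3, -, h5⟩ := hξA _ he hce
    have hne : D.pos c ≠ ξ s(v, c) := fun h => hr.ne (by rw [← h1, ← h, dist_self])
    rw [harc1 _ hce]
    exact (h5 v rfl).union (isArc_segment hne).symm fun q hq => h3 ⟨hq.1, hsegC _ he hce hq.2⟩
  refine ⟨⟨D.pos, D.pos_inj, arc', ?_, ?_, ?_⟩, r, ξ, hr, ⟨hposC, ?_, ?_, ?_, hξne⟩, ?_⟩
  · rintro e he u v rfl
    by_cases hce : c ∈ s(u, v)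
    · rcases Sym2.mem_iff.1 hce with rfl | rfl
      · rw [Sym2.eq_swap] at he ⊢
        exact (hcurve v he).symm
      · exact hcurve u he
    · rw [harc2 _ hce]
      exact D.arc_curve _ he u v rfl
  · intro e he v hv
    by_cases hce : c ∈ e
    · by_cases hvc : v = c
      · exact hvc ▸ hce
      rw [harc1 e hce] at hv
      rcases hv with hv | hv
      · exact D.arc_avoid e he v ((hξA e he hce).2.1 hv)
      · exact absurd (hsegC e he hce hv) (hposC v hvc)
    · rw [harc2 e hce] at hv
      exact D.arc_avoid e he v hv
  · intro e he e' he' hne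
    exact ((D.arc_finite_inter e he e' he' hne).union (finite_singleton _)).subset
      (hinter e he e' he' hne)
  · intro e he hce
    rw [disjoint_left]
    intro q hq
    exact harcC e he hce q (harc2 e hce ▸ hq)
  · exact fun e he hce => (hξA e he hce).1
  · intro e he hce
    change arc' e ∩ C = segment ℝ (D.pos c) (ξ e)
    rw [harc1 e hce]
    apply Subset.antisymm
    · rintro q ⟨hq | hq, hqC⟩
      · rw [show q = ξ e from (hξA e he hce).2.2.1 ⟨hq, hqC⟩]
        exact right_mem_segment ℝ _ _
      · exact hq
    · exact fun q hq => ⟨Or.inr hq, hsegC e he hce hq⟩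
  · rintro e e' p ⟨he, he', hne, hp, hp', hpos⟩
    rcases hinter e he e' he' hne ⟨hp, hp'⟩ with h | h
    · exact ⟨he, he', hne, h.1, h.2, hpos⟩
    · exact absurd ⟨c, h.symm⟩ hpos

theorem IsArc.of_sym2_eq {f : V → ℝ × ℝ} {A : Set (ℝ × ℝ)} {a b u v : V}
    (h : IsArc A (f a) (f b)) (he : s(a, b) = s(u, v)) : IsArc A (f u) (f v) := by
  rcases Sym2.eq_iff.1 he with ⟨rfl, rfl⟩ | ⟨rfl, rfl⟩
  · exact h
  · exact h.symm

/-- If `w` has only the neighbours `a` and `c`, and the edge `wa` crosses the edge `cd`, then the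
edges `wa`, `wc` and `cd` can be redrawn without crossings, keeping all other edges. -/
theorem Drawing.IsRadialAt.exists_uncrossed [Finite V] {D : Drawing G} {w a c d : V} {r : ℝ}
    {ξ : Sym2 V → ℝ × ℝ} {p : ℝ × ℝ} (hrad : D.IsRadialAt c r ξ) (hr : 0 < r)
    (hD : D.IsOnePlanar) (hcross : D.Crosses s(w, a) s(c, d) p) (hwc : G.Adj w c)
    (hN : ∀ x, G.Adj w x → x = a ∨ x = c) :
    ∃ D' : Drawing G, (∀ e e' q, D'.Crosses e e' q → D.Crosses e e' q) ∧
      ∀ q, ¬ D'.Crosses s(w, a) s(c, d) q := by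
  classical
  obtain ⟨hwa, hcd, -, hpwa, hpcd, hppos⟩ := id hcross
  have hadj := hD.2 _ _ _ hcross
  have hwa' : w ≠ a := G.ne_of_adj hwa
  have hcd' : c ≠ d := G.ne_of_adj hcd
  have hwc' : w ≠ c := G.ne_of_adj hwc
  have hwd' : w ≠ d := fun h => hadj w (Sym2.mem_mk_left _ _) (h ▸ Sym2.mem_mk_right _ _)
  have hac' : a ≠ c := fun h => hadj a (Sym2.mem_mk_right _ _) (h ▸ Sym2.mem_mk_left _ _)
  let O : Set (Sym2 V) := {e ∈ G.edgeSet | e ≠ s(w, a) ∧ e ≠ s(w, c) ∧ e ≠ s(c, d)}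
  have hOw : ∀ e ∈ O, w ∉ e := by
    rintro e ⟨he, h1, h2, -⟩ hwe
    obtain ⟨v, rfl⟩ := Sym2.mem_iff_exists.1 hwe
    rcases hN v he with rfl | rfl
    · exact h1 rfl
    · exact h2 rfl
  let R : Set (ℝ × ℝ) := (⋃ e ∈ O, D.arc e) ∪ D.pos '' {v | v ≠ w}
  have hR : IsClosed R :=
    ((toFinite _).isClosed_biUnion fun e he => (D.isCompact_arc he.1).isClosed).union
      (toFinite _).isClosed
  have hposR : ∀ v, v ≠ w → D.pos v ∈ R := fun v hv => Or.inr ⟨v, hv, rfl⟩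
  have harcR : ∀ e ∈ O, D.arc e ⊆ R := fun e he q hq => Or.inl (mem_biUnion he hq)
  -- A point of a crossing edge that lies on `R` is an endpoint.
  have hend : ∀ f f', D.Crosses f f' p → f ∉ O → f' ∉ O → ∀ q ∈ D.arc f, q ∈ R →
      ∃ v ∈ f, q = D.pos v := by
    intro f f' hff' hfO hf'O q hq hqR
    by_cases hqpos : q ∈ range D.pos
    · obtain ⟨v, rfl⟩ := hqpos
      exact ⟨v, D.arc_avoid f hff'.1 v hq, rfl⟩
    · rcases hqR with hqR | ⟨v, -, rfl⟩
      · simp only [mem_iUnion] at hqR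
        obtain ⟨e, he, hqe⟩ := hqR
        have hfe : f ≠ e := fun h => hfO (h ▸ he)
        have := (hD.1 f f' e p q hff' ⟨hff'.1, he.1, hfe, hq, hqe, hqpos⟩).1
        exact absurd (this ▸ he) hf'O
      · exact absurd (mem_range_self v) hqpos
  have hwaO : s(w, a) ∉ O := fun h => h.2.1 rfl
  have hwcO : s(w, c) ∉ O := fun h => h.2.2.1 rfl
  have hcdO : s(c, d) ∉ O := fun h => h.2.2.2 rfl
  have hsub : ∀ u v : V, IsArc (D.arc s(u, v)) (D.pos u) (D.pos v) → p ∈ D.arc s(u, v) →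
      ∃ A ⊆ D.arc s(u, v), IsArc A (D.pos u) p ∧ D.pos v ∉ A := by
    intro u v harc hp
    obtain ⟨z, A, hA, hAz, hzp, -, -, hv⟩ := harc.exists_initial (C := {p}) isClosed_singleton
      (fun h => hppos ⟨u, h⟩) ⟨p, hp, rfl⟩
    rw [mem_singleton_iff] at hzp
    subst hzp
    exact ⟨A, hA, hAz, fun h => hppos ⟨v, hv h⟩⟩
  obtain ⟨A, hAsub, hA, hwA⟩ := hsub a w (D.arc_curve _ (Sym2.eq_swap ▸ hwa) a w rfl)
    (Sym2.eq_swap ▸ hpwa)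
  obtain ⟨B, hBsub, hB, hcB⟩ := hsub d c (D.arc_curve _ (Sym2.eq_swap ▸ hcd) d c rfl)
    (Sym2.eq_swap ▸ hpcd)
  rw [Sym2.eq_swap] at hAsub hBsub
  have hAR : A ∩ R ⊆ {D.pos a} := by
    rintro q ⟨hq, hqR⟩
    obtain ⟨v, hv, rfl⟩ := hend _ _ hcross hwaO hcdO q (hAsub hq) hqR
    rcases Sym2.mem_iff.1 hv with rfl | rfl
    · exact absurd hq hwA
    · rfl
  have hcdR : ∀ q ∈ D.arc s(c, d), q ∈ R → q = D.pos c ∨ q = D.pos d := by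
    intro q hq hqR
    obtain ⟨v, hv, rfl⟩ := hend _ _ hcross.symm hcdO hwaO q hq hqR
    rcases Sym2.mem_iff.1 hv with rfl | rfl
    · exact Or.inl rfl
    · exact Or.inr rfl
  have hBR : B ∩ R ⊆ {D.pos d} := by
    rintro q ⟨hq, hqR⟩
    rcases hcdR q (hBsub hq) hqR with rfl | rfl
    · exact absurd hq hcB
    · rfl
  have hAB : A ∩ B ⊆ {p} := by
    rintro q ⟨hqA, hqB⟩
    by_cases hqpos : q ∈ range D.pos
    · obtain ⟨v, rfl⟩ := hqpos
      exact absurd (D.arc_avoid _ hcd v (hBsub hqB)) (hadj v (D.arc_avoid _ hwa v (hAsub hqA)))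
    · exact (hD.1 _ _ _ p q hcross ⟨hwa, hcd, hcross.2.2.1, hAsub hqA, hBsub hqB, hqpos⟩).2.symm
  have hcmem : c ∈ s(c, d) := Sym2.mem_mk_left _ _
  obtain ⟨Q, hQ, hcQ, hQball, ⟨y, hyQ, hyseg⟩, hQX, hstar⟩ :=
    exists_lens (X := ξ '' {e ∈ G.edgeSet | c ∈ e ∧ e ≠ s(c, d)}) hr (hrad.dist_eq _ hcd hcmem)
      (toFinite _) (by rintro _ ⟨e, he, rfl⟩; exact hrad.dist_eq e he.1 he.2.1)
      (by rintro ⟨e, he, h⟩; exact hrad.ne e he.1 he.2.1 _ hcd hcmem he.2.2 h)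
  have hQR : Q ∩ R ⊆ {D.pos c} := by
    rintro q ⟨hq, hqR | ⟨v, hv, rfl⟩⟩
    · simp only [mem_iUnion] at hqR
      obtain ⟨e, he, hqe⟩ := hqR
      by_cases hce : c ∈ e
      · refine hQX (ξ e) ⟨e, ⟨he.1, hce, he.2.2.2⟩, rfl⟩ ⟨?_, hq⟩
        rw [← hrad.arc_inter e he.1 hce]
        exact ⟨hqe, hQball hq⟩
      · exact absurd (hQball hq) (disjoint_left.1 (hrad.disjoint e he.1 hce) hqe)
    · by_cases hvc : v = c
      · exact congrArg D.pos hvc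
      · exact absurd (hQball hq) (hrad.pos_notMem v hvc)
  have hyT : y ∈ D.arc s(c, d) \ {D.pos c, D.pos d} := by
    have h1 : y ∈ D.arc s(c, d) ∩ closedBall (D.pos c) r := by
      rw [hrad.arc_inter _ hcd hcmem]
      exact openSegment_subset_segment _ _ _ hyseg
    refine ⟨h1.1, ?_⟩
    rintro (rfl | rfl)
    · rw [left_mem_openSegment_iff] at hyseg
      have := hrad.dist_eq _ hcd hcmem
      rw [← hyseg, dist_self] at this
      exact hr.ne this
    · exact hrad.pos_notMem d hcd'.symm h1.2
  obtain ⟨x, A', B', hA', hxc, hB', hxR, hA'R, hsegR, hB'R, hA'seg, hdisjAB, hsegB'⟩ :=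
    exists_rerouting hR (hposR a hwa'.symm) (hposR c hwc'.symm) (hposR d hwd'.symm)
      (D.pos_inj.ne hac') (D.pos_inj.ne hcd'.symm) hA hB hAR hBR hAB
      (D.arc_curve _ hcd c d rfl).isPreconnected_diff
      (fun q hq hqR => hq.2 (hcdR q hq.1 hqR))
      ⟨hpcd, by rintro (h | h) <;> exact hppos ⟨_, h.symm⟩⟩ hyT hQ hcQ hQR hyQ hstar
  let pos' : V → ℝ × ℝ := Function.update D.pos w x
  have hpos'w : pos' w = x := Function.update_self ..
  have hpos' : ∀ v, v ≠ w → pos' v = D.pos v := fun v hv => Function.update_of_ne hv ..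
  let arc' : Sym2 V → Set (ℝ × ℝ) := fun e =>
    if e = s(w, a) then A' else if e = s(w, c) then segment ℝ (D.pos c) x else
      if e = s(c, d) then B' else D.arc e
  have hwawc : s(w, c) ≠ s(w, a) := fun h => hac' (Sym2.congr_right.1 h).symm
  have hcdwa : s(c, d) ≠ s(w, a) := hcross.2.2.1.symm
  have hcdwc : s(c, d) ≠ s(w, c) := fun h => by
    have : w ∈ s(c, d) := h ▸ Sym2.mem_mk_left w c
    rcases Sym2.mem_iff.1 this with h | h
    · exact hwc' h
    · exact hwd' h
  have harcwa : arc' s(w, a) = A' := if_pos rfl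
  have harcwc : arc' s(w, c) = segment ℝ (D.pos c) x := by simp only [arc', if_neg hwawc, if_true]
  have harccd : arc' s(c, d) = B' := by simp only [arc', if_neg hcdwa, if_neg hcdwc, if_true]
  have harcO : ∀ e ∈ O, arc' e = D.arc e := fun e he => by
    simp only [arc', if_neg he.2.1, if_neg he.2.2.1, if_neg he.2.2.2]
  have hcases : ∀ e ∈ G.edgeSet, e = s(w, a) ∨ e = s(w, c) ∨ e = s(c, d) ∨ e ∈ O := by
    intro e he
    by_contra! h
    exact h.2.2.2 ⟨he, h.1, h.2.1, h.2.2.1⟩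
  have hxB' : x ∉ B' := disjoint_left.1 hdisjAB hA'.right_mem
  have hxarc : ∀ e ∈ O, x ∉ D.arc e := fun e he h => hxR (harcR e he h)
  have hrange : ∀ v, v ≠ w → D.pos v ∈ range pos' := fun v hv => ⟨v, hpos' v hv⟩
  have hspecialR : ∀ e ∈ G.edgeSet, e ∉ O → arc' e ∩ R ⊆ range pos' := by
    rintro e he heO q ⟨hq, hqR⟩
    rcases hcases e he with rfl | rfl | rfl | h
    · rw [harcwa] at hq
      exact (hA'R ⟨hq, hqR⟩ : q = D.pos a) ▸ hrange a hwa'.symm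
    · rw [harcwc] at hq
      exact (hsegR ⟨hq, hqR⟩ : q = D.pos c) ▸ hrange c hwc'.symm
    · rw [harccd] at hq
      rcases hB'R ⟨hq, hqR⟩ with rfl | rfl
      · exact hrange c hwc'.symm
      · exact hrange d hwd'.symm
    · exact absurd h heO
  have h_wa_wc : arc' s(w, a) ∩ arc' s(w, c) ⊆ range pos' := by
    rw [harcwa, harcwc]
    exact hA'seg.trans (singleton_subset_iff.2 ⟨w, hpos'w⟩)
  have h_wa_cd : arc' s(w, a) ∩ arc' s(c, d) ⊆ range pos' := by
    rw [harcwa, harccd, hdisjAB.inter_eq]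
    exact empty_subset _
  have h_wc_cd : arc' s(w, c) ∩ arc' s(c, d) ⊆ range pos' := by
    rw [harcwc, harccd]
    exact hsegB'.trans (singleton_subset_iff.2 (hrange c hwc'.symm))
  have hspecial : ∀ e ∈ G.edgeSet, e ∉ O → ∀ e' ∈ G.edgeSet, e ≠ e' →
      arc' e ∩ arc' e' ⊆ range pos' := by
    intro e he heO e' he' hne
    by_cases he'O : e' ∈ O
    · rw [harcO e' he'O]
      exact (inter_subset_inter_right _ (harcR e' he'O)).trans (hspecialR e he heO)
    · rcases hcases e he with rfl | rfl | rfl | h <;>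
        rcases hcases e' he' with rfl | rfl | rfl | h' <;>
        first
        | exact absurd rfl hne
        | exact absurd h heO
        | exact absurd h' he'O
        | assumption
        | (rw [inter_comm]; assumption)
  have hO : ∀ e ∈ G.edgeSet, ∀ e' ∈ G.edgeSet, e ≠ e' →
      arc' e ∩ arc' e' ⊆ range pos' ∨ e ∈ O ∧ e' ∈ O := by
    intro e he e' he' hne
    by_cases h : e ∈ O
    · by_cases h' : e' ∈ O
      · exact Or.inr ⟨h, h'⟩
      · exact Or.inl (inter_comm (arc' e) _ ▸ hspecial e' he' h' e he hne.symm)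
    · exact Or.inl (hspecial e he h e' he' hne)
  have hinj : Function.Injective pos' := by
    have hxpos : ∀ v, v ≠ w → D.pos v ≠ x := fun v hv h => hxR (h ▸ hposR v hv)
    intro u v huv
    by_cases hu : u = w <;> by_cases hv : v = w
    · rw [hu, hv]
    · rw [hu, hpos'w, hpos' v hv] at huv
      exact absurd huv.symm (hxpos v hv)
    · rw [hv, hpos'w, hpos' u hu] at huv
      exact absurd huv (hxpos u hu)
    · rw [hpos' u hu, hpos' v hv] at huv
      exact D.pos_inj huv
  refine ⟨⟨pos', hinj, arc', ?_, ?_, ?_⟩, ?_, ?_⟩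
  · intro e he u v huv
    rcases hcases e he with rfl | rfl | rfl | h
    · refine IsArc.of_sym2_eq ?_ huv
      rw [harcwa, hpos'w, hpos' a hwa'.symm]
      exact hA'.symm
    · refine IsArc.of_sym2_eq ?_ huv
      rw [harcwc, hpos'w, hpos' c hwc'.symm]
      exact (isArc_segment hxc.symm).symm
    · refine IsArc.of_sym2_eq ?_ huv
      rw [harccd, hpos' c hwc'.symm, hpos' d hwd'.symm]
      exact hB'.symm
    · have huw : u ≠ w := fun hu => hOw e h (by rw [huv, hu]; exact Sym2.mem_mk_left _ _)
      have hvw : v ≠ w := fun hv => hOw e h (by rw [huv, hv]; exact Sym2.mem_mk_right _ _)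
      rw [harcO e h, hpos' u huw, hpos' v hvw]
      exact D.arc_curve e he u v huv
  · intro e he v hv
    by_cases hvw : v = w
    · subst hvw
      rw [hpos'w] at hv
      rcases hcases e he with rfl | rfl | rfl | h
      · exact Sym2.mem_mk_left _ _
      · exact Sym2.mem_mk_left _ _
      · exact absurd (harccd ▸ hv) hxB'
      · exact absurd (harcO e h ▸ hv) (hxarc e h)
    · rw [hpos' v hvw] at hv
      rcases hcases e he with rfl | rfl | rfl | h
      · rw [harcwa] at hv
        rw [D.pos_inj (hA'R ⟨hv, hposR v hvw⟩ : D.pos v = D.pos a)]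
        exact Sym2.mem_mk_right _ _
      · rw [harcwc] at hv
        rw [D.pos_inj (hsegR ⟨hv, hposR v hvw⟩ : D.pos v = D.pos c)]
        exact Sym2.mem_mk_right _ _
      · rw [harccd] at hv
        rcases hB'R ⟨hv, hposR v hvw⟩ with h | h
        · rw [D.pos_inj h]
          exact Sym2.mem_mk_left _ _
        · rw [D.pos_inj h]
          exact Sym2.mem_mk_right _ _
      · rw [harcO e h] at hv
        exact D.arc_avoid e he v hv
  · intro e he e' he' hne
    rcases hO e he e' he' hne with h | ⟨h, h'⟩
    · exact (toFinite _).subset h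
    · rw [harcO e h, harcO e' h']
      exact D.arc_finite_inter e he e' he' hne
  · rintro e e' q ⟨he, he', hne, hq, hq', hqpos⟩
    rcases hO e he e' he' hne with h | ⟨h, h'⟩
    · exact absurd (h ⟨hq, hq'⟩) hqpos
    · have hqe : q ∈ D.arc e := harcO e h ▸ hq
      refine ⟨he, he', hne, hqe, harcO e' h' ▸ hq', ?_⟩
      rintro ⟨v, rfl⟩
      have hvw : v ≠ w := fun hvw => hOw e h (hvw ▸ D.arc_avoid e he v hqe)
      exact hqpos (hrange v hvw)
  · rintro q ⟨-, -, -, hqwa, hqcd, hqpos⟩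
    exact hqpos (h_wa_cd ⟨hqwa, hqcd⟩)

/-- A vertex of degree two on a crossing edge is adjacent to an endpoint of the other edge. -/
theorem Drawing.IsSRestricted.exists_adj {D : Drawing G} {S : Set CrossingType}
    (hD : D.IsSRestricted S) (hS : S ⊆ goodTypes) {w a c d : V} {p : ℝ × ℝ}
    (h : D.Crosses s(w, a) s(c, d) p) : G.Adj w c ∨ G.Adj w d := by
  obtain ⟨t, ht, htype⟩ := hD.2 w a c d p h
  rcases hS ht with rfl | rfl | rfl <;> simp only [HasCrossingType] at htype <;> tauto

/-- A crossing on an edge at a vertex of degree two can be removed. -/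
theorem Drawing.IsSRestricted.exists_uncrossed [Finite V] {D : Drawing G} {S : Set CrossingType}
    (hD : D.IsSRestricted S) (hS : S ⊆ goodTypes) {e e' : Sym2 V} {p : ℝ × ℝ}
    (hcross : D.Crosses e e' p) {w : V} (hwe : w ∈ e) (hw : DegTwo G w) :
    ∃ D' : Drawing G, (∀ f f' q, D'.Crosses f f' q → D.Crosses f f' q) ∧
      ∀ q, ¬ D'.Crosses e e' q := by
  obtain ⟨a, rfl⟩ := Sym2.mem_iff_exists.1 hwe
  obtain ⟨c, d, rfl, hwc⟩ : ∃ c d, e' = s(c, d) ∧ G.Adj w c := by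
    induction e' with | _ c d =>
    rcases hD.exists_adj hS hcross with h | h
    · exact ⟨c, d, rfl, h⟩
    · exact ⟨d, c, Sym2.eq_swap, h⟩
  have hac : a ≠ c := fun h =>
    hD.1.2 _ _ _ hcross a (Sym2.mem_mk_right _ _) (h ▸ Sym2.mem_mk_left _ _)
  have hN : ∀ x, G.Adj w x → x = a ∨ x = c := by
    obtain ⟨b, b', -, hb⟩ := hw
    have hmem : ∀ x, G.Adj w x → x = b ∨ x = b' := fun x hx => by
      have : x ∈ G.neighborSet w := hx
      rwa [hb] at this
    intro x hx
    have h1 := hmem x hx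
    have h2 := hmem a hcross.1
    have h3 := hmem c hwc
    grind
  obtain ⟨D₁, r, ξ, hr, hrad, hsub⟩ := D.exists_isRadialAt c
  by_cases h : ∃ q, D₁.Crosses s(w, a) s(c, d) q
  · obtain ⟨q, hq⟩ := h
    obtain ⟨D₂, hsub', hnot⟩ :=
      hrad.exists_uncrossed hr (hD.of_crosses_subset hsub).1 hq hwc hN
    exact ⟨D₂, fun f f' q h => hsub _ _ _ (hsub' _ _ _ h), hnot⟩
  · exact ⟨D₁, hsub, fun q hq => h ⟨q, hq⟩⟩

end

/-- **Degree-two vertices can be kept crossing-free.** Assume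
`S ⊆ {full, almost-full, bowtie}`.  A graph `G` is `S`-restricted if and only if there is
an `S`-restricted drawing of `G` in which no edge incident to a degree-two vertex is
crossed. -/
theorem srestricted_iff_degree_two_uncrossed {V : Type*} [Fintype V] (G : SimpleGraph V)
    (S : Set CrossingType) (hS : S ⊆ goodTypes) :
    SRestricted G S ↔
      ∃ D : Drawing G, D.IsSRestricted S ∧
        ∀ e e' p, D.Crosses e e' p → ∀ v : V, v ∈ e → ¬ DegTwo G v := by
  refine ⟨?_, fun ⟨D, hD, _⟩ => ⟨D, hD⟩⟩
  rintro ⟨D, hD⟩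
  induction hn : {f : Sym2 V × Sym2 V | ∃ q, D.Crosses f.1 f.2 q}.ncard
    using Nat.strong_induction_on generalizing D with
  | _ n ih =>
    by_contra hcon
    have hbad : ¬ ∀ e e' p, D.Crosses e e' p → ∀ v : V, v ∈ e → ¬ DegTwo G v :=
      fun h => hcon ⟨D, hD, h⟩
    push Not at hbad
    obtain ⟨e, e', p, hcross, w, hwe, hw⟩ := hbad
    obtain ⟨D', hsub, hnot⟩ := hD.exists_uncrossed hS hcross hwe hw
    refine hcon (ih _ ?_ D' (hD.of_crosses_subset hsub) rfl)
    rw [← hn]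
    refine ncard_lt_ncard ⟨fun f ⟨q, hq⟩ => ⟨q, hsub _ _ _ hq⟩, fun h => ?_⟩ (toFinite _)
    obtain ⟨q, hq⟩ := @h (e, e') ⟨p, hcross⟩
    exact hnot q hq

end OnePlanarity
end
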